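/- arXiv:2508.07823 — 2 statements merged into one kernel-verified Lean document; each statement's English description precedes it below -/
import Mathlib

section
/- There exists a constant c > 0 such that for every integer n ≥ 2 and every deterministic online sorting strategy s for array size n, the expected cost satisfies E_x[cost(s,x)] ≥ c · log n, where the expectation is over an input x of n i.i.d. uniform samples from [0,1]. (Since a randomized algorithm is a mixture of deterministic ones, this yields the Ω(log n) lower bound for randomized algorithms as well.) -/
open MeasureTheory

/-- The distribution of `n` i.i.d. uniform samples from `[0,1]`. -/
noncomputable def uniformCube (n : ℕ) : Measure (Fin n → ℝ) :=
  Measure.pi fun _ => (volume : Measure ℝ).restrict (Set.Icc 0 1)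

/-- A deterministic online sorting strategy for array size `n`: upon arrival of the
`(k+1)`-st item, it is placed into cell `place x k`, which depends only on the first
`k+1` items and is distinct from all previously used cells. -/
structure OnlineStrategy (n : ℕ) where
  place : (Fin n → ℝ) → Fin n → Fin n
  online : ∀ x y : Fin n → ℝ, ∀ k : Fin n,
    (∀ i : Fin n, i ≤ k → x i = y i) → place x k = place y k
  inj : ∀ x : Fin n → ℝ, Function.Injective (place x)
  meas : ∀ k : Fin n, Measurable fun x => place x k

/-- The final array produced by the strategy (cells indexed `0,…,n-1`):
cell `j` holds the item inserted at the unique time `k` with `place x k = j`. -/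
noncomputable def strategyArr {n : ℕ} (S : OnlineStrategy n) (x : Fin n → ℝ) (j : ℕ) : ℝ :=
  if h : j < n then
    haveI : Nonempty (Fin n) := ⟨⟨j, h⟩⟩
    x (Function.invFun (S.place x) ⟨j, h⟩)
  else 0

/-- The cost: the sum of absolute differences between adjacent cells. -/
noncomputable def strategyCost {n : ℕ} (S : OnlineStrategy n) (x : Fin n → ℝ) : ℝ :=
  ∑ j ∈ Finset.range (n - 1), |strategyArr S x (j + 1) - strategyArr S x j|

open Finset in
/-- Given the cells `p i` used by the items `i`, the items arriving before time `k` that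
are adjacent to a cell which is still empty just before time `k`. -/
noncomputable def openNeighbors {n : ℕ} (p : Fin n → Fin n) (k : Fin n) : Finset (Fin n) :=
  open Classical in
  univ.filter fun a => a < k ∧
    ∃ c : Fin n, (∀ i < k, p i ≠ c) ∧ ((p a : ℕ) + 1 = c ∨ (c : ℕ) + 1 = p a)

lemma card_openNeighbors_le {n : ℕ} {p : Fin n → Fin n} (hp : Function.Injective p)
    (k : Fin n) : (openNeighbors p k).card ≤ (n - k) * 2 := by
  classical
  have hE : (Finset.univ \ (Finset.Iio k).image p).card = n - k := by
    rw [Finset.card_sdiff_of_subset (Finset.subset_univ _), Finset.card_image_of_injective _ hp]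
    simp
  rw [← hE]
  refine le_trans (Finset.card_le_card (t := (Finset.univ \ (Finset.Iio k).image p).biUnion
    fun c => Finset.univ.filter fun a => (p a : ℕ) + 1 = c ∨ (c : ℕ) + 1 = p a) ?_)
    (Finset.card_biUnion_le_card_mul _ _ _ ?_)
  · intro a ha
    simp only [openNeighbors, Finset.mem_filter, Finset.mem_univ, true_and] at ha
    obtain ⟨-, c, hc, h⟩ := ha
    simp only [Finset.mem_biUnion, Finset.mem_sdiff, Finset.mem_univ, true_and,
      Finset.mem_image, Finset.mem_Iio, Finset.mem_filter, not_exists, not_and]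
    exact ⟨c, hc, h⟩
  · intro c _
    rw [Finset.filter_or]
    refine (Finset.card_union_le _ _).trans (Nat.add_le_add (b := 1) (d := 1) ?_ ?_)
    all_goals
      refine Finset.card_le_one.2 fun a ha b hb => hp (Fin.ext ?_)
      simp only [Finset.mem_filter, Finset.mem_univ, true_and] at ha hb
      omega

lemma openNeighbors_congr {n : ℕ} {p q : Fin n → Fin n} {k : Fin n}
    (h : ∀ i < k, p i = q i) : openNeighbors p k = openNeighbors q k := by
  ext a
  simp only [openNeighbors, Finset.mem_filter, Finset.mem_univ, true_and]
  refine and_congr_right fun ha => exists_congr fun c => ?_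
  rw [h a ha]
  refine and_congr_left fun _ => forall₂_congr fun i hi => ?_
  rw [h i hi]

lemma OnlineStrategy.openNeighbors_update {n : ℕ} (S : OnlineStrategy n) (k : Fin n)
    (x : Fin n → ℝ) (y : ℝ) :
    openNeighbors (S.place (Function.update x k y)) k = openNeighbors (S.place x) k :=
  openNeighbors_congr fun i hi => S.online _ _ i fun _ hj =>
    Function.update_of_ne (hj.trans_lt hi).ne _ _

instance isProbabilityMeasure_restrict_Icc :
    IsProbabilityMeasure ((volume : Measure ℝ).restrict (Set.Icc 0 1)) :=
  ⟨by simp⟩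

instance (n : ℕ) : IsProbabilityMeasure (uniformCube n) := by
  unfold uniformCube; infer_instance

/-- The event that item `k` is within `r` of the item `a`, and `a` has an empty neighbouring
cell when `k` arrives. -/
def closeEvent {n : ℕ} (S : OnlineStrategy n) (r : ℝ) (k a : Fin n) : Set (Fin n → ℝ) :=
  {x | a ∈ openNeighbors (S.place x) k ∧ |x k - x a| < r}

lemma measurableSet_closeEvent {n : ℕ} (S : OnlineStrategy n) (r : ℝ) (k a : Fin n) :
    MeasurableSet (closeEvent S r k a) := by
  refine MeasurableSet.inter ?_ ?_
  · have h : Measurable fun x => S.place x := measurable_pi_lambda _ S.meas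
    exact h (t := {p | a ∈ openNeighbors p k}) (Set.toFinite _).measurableSet
  · exact measurableSet_lt (f := fun x : Fin n → ℝ => |x k - x a|) (by fun_prop)
      measurable_const

lemma sum_measureReal_closeEvent_le {n : ℕ} (S : OnlineStrategy n) {δ : ℝ} (hδ : 0 ≤ δ)
    (k : Fin n) :
    ∑ a, (uniformCube n).real (closeEvent S (δ / ((n : ℝ) - k)) k a) ≤ 4 * δ := by
  classical
  set r : ℝ := δ / ((n : ℝ) - k) with hr
  have hk : (0 : ℝ) < (n : ℝ) - k := by
    have := k.isLt
    have : (k : ℝ) < n := by exact_mod_cast this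
    linarith
  have hr0 : 0 ≤ r := by positivity
  let f : (Fin n → ℝ) → ENNReal := fun x => ∑ a, (closeEvent S r k a).indicator 1 x
  have hf : Measurable f := Finset.measurable_sum _ fun a _ =>
    measurable_one.indicator (measurableSet_closeEvent S r k a)
  have hball (z : ℝ) : ((volume : Measure ℝ).restrict (Set.Icc 0 1)) {y | |y - z| < r} ≤
      ENNReal.ofReal (2 * r) := by
    refine (Measure.restrict_apply_le _ _).trans ?_
    rw [← Real.volume_ball]
    rfl
  have key : ∫⁻ x, f x ∂(uniformCube n) ≤ ∫⁻ _, ENNReal.ofReal (4 * δ) ∂(uniformCube n) := by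
    refine lintegral_le_of_lmarginal_le {k} hf measurable_const fun x => ?_
    rw [lmarginal_singleton, lmarginal_singleton]
    simp only [lintegral_const, measure_univ, mul_one]
    have hle : ∀ y, f (Function.update x k y) ≤
        ∑ a ∈ openNeighbors (S.place x) k, {y | |y - x a| < r}.indicator 1 y := by
      intro y
      simp only [f]
      rw [← Finset.sum_subset (Finset.subset_univ (openNeighbors (S.place x) k))]
      · refine Finset.sum_le_sum fun a ha => ?_
        have hak : a ≠ k := by
          simp only [openNeighbors, Finset.mem_filter] at ha
          exact ha.2.1.ne
        simp only [Set.indicator_apply, closeEvent, Set.mem_ofPred_eq, S.openNeighbors_update,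
          Function.update_self, Function.update_of_ne hak, ha, true_and,
          Pi.one_apply, le_refl]
      · intro a _ ha
        simp [closeEvent, S.openNeighbors_update, ha]
    refine (lintegral_mono hle).trans ?_
    have hm (a : Fin n) : MeasurableSet {y : ℝ | |y - x a| < r} :=
      measurableSet_lt (by fun_prop) measurable_const
    rw [lintegral_finsetSum _ fun a _ => measurable_one.indicator (hm a)]
    simp only [lintegral_indicator_one (hm _)]
    refine (Finset.sum_le_card_nsmul _ _ _ fun a _ => hball (x a)).trans ?_
    rw [nsmul_eq_mul, ← ENNReal.ofReal_natCast, ← ENNReal.ofReal_mul (by positivity)]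
    refine ENNReal.ofReal_le_ofReal ?_
    have hc : ((openNeighbors (S.place x) k).card : ℝ) ≤ ((n : ℝ) - k) * 2 := by
      rw [← Nat.cast_sub k.isLt.le]
      exact_mod_cast card_openNeighbors_le (S.inj x) k
    calc _ ≤ (((n : ℝ) - k) * 2) * (2 * r) := by gcongr
      _ = 4 * δ := by rw [hr]; field_simp; ring
  simp only [lintegral_const, measure_univ, mul_one] at key
  rw [lintegral_finsetSum _ fun a _ =>
    measurable_one.indicator (measurableSet_closeEvent S r k a)] at key
  simp only [lintegral_indicator_one (measurableSet_closeEvent S r k _)] at key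
  simp only [measureReal_def]
  rw [← ENNReal.toReal_sum fun a _ => measure_ne_top _ _]
  exact ENNReal.toReal_le_of_le_ofReal (by positivity) key

lemma strategyArr_eq {n : ℕ} (S : OnlineStrategy n) (x : Fin n → ℝ) {j : ℕ} {k : Fin n}
    (h : (S.place x k : ℕ) = j) : strategyArr S x j = x k := by
  subst h
  have : Nonempty (Fin n) := ⟨k⟩
  have hk : Function.invFun (S.place x) (S.place x k) = k :=
    Function.leftInverse_invFun (S.inj x) k
  simp only [strategyArr, Fin.is_lt, dif_pos, Fin.eta]
  rw [hk]

lemma OnlineStrategy.exists_place_eq {n : ℕ} (S : OnlineStrategy n) (x : Fin n → ℝ)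
    {j : ℕ} (hj : j < n) : ∃ k, (S.place x k : ℕ) = j := by
  obtain ⟨k, hk⟩ := (Finite.injective_iff_surjective.1 (S.inj x)) ⟨j, hj⟩
  exact ⟨k, by rw [hk]⟩

lemma measurable_strategyArr {n : ℕ} (S : OnlineStrategy n) (j : ℕ) :
    Measurable fun x => strategyArr S x j := by
  by_cases hj : j < n
  · have : (fun x => strategyArr S x j) =
        fun x => ∑ k, if S.place x k = ⟨j, hj⟩ then x k else 0 := by
      funext x
      obtain ⟨k, hk⟩ := S.exists_place_eq x hj
      rw [strategyArr_eq S x hk, Finset.sum_eq_single k]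
      · rw [if_pos (Fin.ext hk)]
      · intro i _ hik
        rw [if_neg]
        intro h
        exact hik (S.inj x (h.trans (Fin.ext hk).symm))
      · simp
    rw [this]
    refine Finset.measurable_sum _ fun k _ => Measurable.ite ?_ (by fun_prop) measurable_const
    exact S.meas k (measurableSet_singleton _)
  · simp [strategyArr, hj]

lemma integrable_strategyCost {n : ℕ} (S : OnlineStrategy n) :
    Integrable (strategyCost S) (uniformCube n) := by
  have hm : Measurable (strategyCost S) := Finset.measurable_sum _ fun j _ =>
    ((measurable_strategyArr S (j + 1)).sub (measurable_strategyArr S j)).abs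
  have hx : ∀ᵐ x ∂(uniformCube n), ∀ k, x k ∈ Set.Icc (0 : ℝ) 1 := by
    refine ae_all_iff.2 fun k => ?_
    exact (Measure.tendsto_eval_ae_ae (μ := fun _ : Fin n =>
      (volume : Measure ℝ).restrict (Set.Icc 0 1)) (i := k)).eventually
      (ae_restrict_mem measurableSet_Icc)
  refine Integrable.of_bound hm.aestronglyMeasurable (∑ _j ∈ Finset.range (n - 1), 1) ?_
  filter_upwards [hx] with x hx
  have harr (j : ℕ) : strategyArr S x j ∈ Set.Icc (0 : ℝ) 1 := by
    unfold strategyArr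
    split_ifs
    · exact hx _
    · simp
  rw [Real.norm_eq_abs, abs_of_nonneg (Finset.sum_nonneg fun _ _ => abs_nonneg _)]
  refine Finset.sum_le_sum fun j _ => abs_le.2 ?_
  have h1 := harr (j + 1)
  have h2 := harr j
  constructor <;> linarith [h1.1, h1.2, h2.1, h2.2]

lemma log_le_sum_inv {n : ℕ} (hn : 2 ≤ n) :
    Real.log n ≤ ∑ k : Fin n, 1 / ((n : ℝ) - k) := by
  have h : ∑ k : Fin n, 1 / ((n : ℝ) - k) = (harmonic n : ℝ) := by
    rw [harmonic, ← Finset.sum_range_reflect, Fin.sum_univ_eq_sum_range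
      (fun k => 1 / ((n : ℝ) - k)) n]
    push_cast
    refine Finset.sum_congr rfl fun k hk => ?_
    have hk := Finset.mem_range.1 hk
    have : ((n - 1 - k : ℕ) : ℝ) = (n : ℝ) - 1 - k := by
      rw [Nat.cast_sub (by omega), Nat.cast_sub (by omega), Nat.cast_one]
    rw [this, one_div]
    congr 1
    ring
  rw [h]
  refine le_trans (Real.log_le_log ?_ ?_) (log_add_one_le_harmonic n)
  · exact_mod_cast (by omega : 0 < n)
  · push_cast
    linarith

/-- Each adjacent pair of cells contributes at least `δ / (n - k)`, where `k` is the time at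
which its second cell is filled, unless the `k`-th item is exceptionally close to an earlier
item next to an empty cell. -/
lemma sum_inv_le_strategyCost_add {n : ℕ} (hn : 2 ≤ n) (S : OnlineStrategy n) {δ : ℝ}
    (hδ : 0 ≤ δ) (x : Fin n → ℝ) :
    δ / 2 * ∑ k : Fin n, 1 / ((n : ℝ) - k) ≤ strategyCost S x +
      ∑ k : Fin n, ∑ a : Fin n, δ / ((n : ℝ) - k) *
        (closeEvent S (δ / ((n : ℝ) - k)) k a).indicator 1 x := by
  classical
  obtain ⟨m, rfl⟩ : ∃ m, n = m + 1 := ⟨n - 1, by omega⟩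
  obtain ⟨σ, hσ⟩ : ∃ σ : Fin (m + 1) ≃ Fin (m + 1), ∀ j, S.place x (σ j) = j :=
    ⟨(Equiv.ofBijective _ (Finite.injective_iff_bijective.1 (S.inj x))).symm,
      Equiv.ofBijective_apply_symm_apply _ _⟩
  let w : Fin (m + 1) → ℝ := fun k => δ / (((m + 1 : ℕ) : ℝ) - k)
  have hpos (k : Fin (m + 1)) : 0 < ((m + 1 : ℕ) : ℝ) - k := by
    have : (k : ℝ) < (m + 1 : ℕ) := by exact_mod_cast k.isLt
    linarith
  have hw (k : Fin (m + 1)) : 0 ≤ w k := div_nonneg hδ (hpos k).le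
  have hmono : Monotone w := fun a b hab => by
    refine div_le_div_of_nonneg_left hδ (hpos b) ?_
    have : (a : ℝ) ≤ b := by exact_mod_cast hab
    linarith
  let g : Fin (m + 1) × Fin (m + 1) → ℝ := fun q =>
    w q.1 * (closeEvent S (w q.1) q.1 q.2).indicator 1 x
  have hg (q) : 0 ≤ g q :=
    mul_nonneg (hw _) (Set.indicator_nonneg (fun _ _ => zero_le_one) _)
  let l : Fin m → Fin (m + 1) := fun j => σ j.castSucc
  let u : Fin m → Fin (m + 1) := fun j => σ j.succ
  let e : Fin m → Fin (m + 1) × Fin (m + 1) := fun j => (max (l j) (u j), min (l j) (u j))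
  have hlu (j) : l j ≠ u j := fun h => by
    have := congrArg Fin.val (σ.injective h)
    simp at this
  have he : Function.Injective e := by
    intro i j hij
    have h1 : max (l i) (u i) = max (l j) (u j) := congrArg Prod.fst hij
    have h2 : min (l i) (u i) = min (l j) (u j) := congrArg Prod.snd hij
    have h3 : (l i = l j ∧ u i = u j) ∨ (l i = u j ∧ u i = l j) := by
      rcases le_total (l i) (u i) with a | a <;> rcases le_total (l j) (u j) with b | b <;>
        simp only [max_eq_left, max_eq_right, min_eq_left, min_eq_right, a, b] at h1 h2 <;>
        simp [h1, h2]
    rcases h3 with ⟨h, -⟩ | ⟨h, h'⟩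
    · have := congrArg Fin.val (σ.injective h)
      exact Fin.ext (by simpa using this)
    · have t1 := congrArg Fin.val (σ.injective h)
      have t2 := congrArg Fin.val (σ.injective h')
      simp at t1 t2
      omega
  have hmem (j) : (e j).2 ∈ openNeighbors (S.place x) (e j).1 := by
    simp only [openNeighbors, Finset.mem_filter, Finset.mem_univ, true_and]
    refine ⟨min_lt_max.2 (hlu j), S.place x (e j).1, fun i hi h => hi.ne (S.inj x h), ?_⟩
    rcases le_total (l j) (u j) with a | a <;>
      simp only [e, max_eq_left, max_eq_right, min_eq_left, min_eq_right, a] <;>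
      simp [l, u, hσ]
  have hedge (j : Fin m) :
      w (e j).1 ≤ |strategyArr S x (j + 1) - strategyArr S x j| + g (e j) := by
    have h1 : strategyArr S x ((j : ℕ) + 1) = x (u j) := strategyArr_eq S x (by simp [u, hσ])
    have h2 : strategyArr S x (j : ℕ) = x (l j) := strategyArr_eq S x (by simp [l, hσ])
    have h3 : |x (u j) - x (l j)| = |x (e j).1 - x (e j).2| := by
      rcases le_total (l j) (u j) with a | a
      · simp [e, a]
      · simp [e, a, abs_sub_comm]
    rw [h1, h2, h3]
    by_cases h : |x (e j).1 - x (e j).2| < w (e j).1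
    · have : x ∈ closeEvent S (w (e j).1) (e j).1 (e j).2 := ⟨hmem j, h⟩
      simp only [g, Set.indicator_of_mem this, Pi.one_apply, mul_one]
      linarith [abs_nonneg (x (e j).1 - x (e j).2)]
    · linarith [hg (e j)]
  have hsum : ∑ j, g (e j) ≤ ∑ q, g q := by
    rw [← Finset.sum_image (f := g) (s := Finset.univ) (g := e) fun _ _ _ _ h => he h]
    exact Finset.sum_le_univ_sum_of_nonneg hg
  have hhalf : ∑ k, w k ≤ 2 * ∑ j, w (e j).1 := by
    have h1 : ∑ k, w k = ∑ k, w (σ k) := (Equiv.sum_comp σ w).symm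
    have h2 : ∑ k, w (σ k) = ∑ j, w (l j) + w (σ (Fin.last m)) := Fin.sum_univ_castSucc _
    have h3 : ∑ j, w (l j) ≤ ∑ j, w (e j).1 :=
      Finset.sum_le_sum fun j _ => hmono (le_max_left _ _)
    have h4 : w (σ (Fin.last m)) ≤ ∑ j, w (e j).1 := by
      let j : Fin m := ⟨m - 1, by omega⟩
      have hj : σ (Fin.last m) = u j := congrArg σ (Fin.ext (by simp [j]; omega))
      rw [hj]
      exact (hmono (le_max_right _ _)).trans
        (Finset.single_le_sum (f := fun j => w (e j).1) (fun i _ => hw _) (Finset.mem_univ j))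
    linarith
  have hcost : strategyCost S x =
      ∑ j : Fin m, |strategyArr S x (j + 1) - strategyArr S x j| := by
    rw [strategyCost, Nat.add_sub_cancel, Finset.sum_range]
  have htot := Finset.sum_le_sum fun j (_ : j ∈ Finset.univ) => hedge j
  rw [Finset.sum_add_distrib, ← hcost] at htot
  have hH : δ / 2 * ∑ k : Fin (m + 1), 1 / (((m + 1 : ℕ) : ℝ) - k) = (∑ k, w k) / 2 := by
    rw [Finset.mul_sum, Finset.sum_div]
    exact Finset.sum_congr rfl fun k _ => by simp only [w]; ring
  have hG : ∑ q, g q = ∑ k, ∑ a, g (k, a) := Fintype.sum_prod_type _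
  rw [hH]
  change _ ≤ strategyCost S x + ∑ k, ∑ a, g (k, a)
  linarith

/-- Any (deterministic) online sorting algorithm on i.i.d. uniform input has
expected cost at least `Ω(log n)`. -/
theorem stochastic_online_sorting_lower_bound :
    ∃ c : ℝ, 0 < c ∧ ∀ n : ℕ, 2 ≤ n → ∀ S : OnlineStrategy n,
      c * Real.log n ≤ ∫ x, strategyCost S x ∂(uniformCube n) := by
  refine ⟨1 / 64, by norm_num, fun n hn S => ?_⟩
  set H : ℝ := ∑ k : Fin n, 1 / ((n : ℝ) - k) with hH
  let w : Fin n → ℝ := fun k => (1 / 16) / ((n : ℝ) - k)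
  let B : (Fin n → ℝ) → ℝ := fun x =>
    ∑ k, ∑ a, w k * (closeEvent S (w k) k a).indicator 1 x
  have hw (k : Fin n) : 0 ≤ w k := by
    have : (k : ℝ) < n := by exact_mod_cast k.isLt
    exact div_nonneg (by norm_num) (by linarith)
  have hI (k a : Fin n) : Integrable
      (fun x => w k * (closeEvent S (w k) k a).indicator (1 : (Fin n → ℝ) → ℝ) x)
      (uniformCube n) :=
    ((integrable_const (1 : ℝ)).indicator (measurableSet_closeEvent S (w k) k a)).const_mul _
  have hB : Integrable B (uniformCube n) :=
    integrable_finsetSum _ fun k _ => integrable_finsetSum _ fun a _ => hI k a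
  have hBle : ∫ x, B x ∂(uniformCube n) ≤ 1 / 64 * H := by
    rw [integral_finsetSum _ fun k _ => integrable_finsetSum _ fun a _ => hI k a,
      hH, Finset.mul_sum]
    refine Finset.sum_le_sum fun k _ => ?_
    rw [integral_finsetSum _ fun a _ => hI k a]
    simp only [integral_const_mul, integral_indicator_one (measurableSet_closeEvent S _ k _)]
    rw [← Finset.mul_sum]
    refine (mul_le_mul_of_nonneg_left
      (sum_measureReal_closeEvent_le S (δ := 1 / 16) (by norm_num) k) (hw k)).trans_eq ?_
    simp only [w]
    ring
  have hlow := integral_mono (integrable_const _) ((integrable_strategyCost S).add hB)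
    (sum_inv_le_strategyCost_add hn S (δ := 1 / 16) (by norm_num))
  simp only [Pi.add_apply] at hlow
  rw [integral_add (integrable_strategyCost S) hB] at hlow
  simp only [integral_const, probReal_univ, one_smul] at hlow
  have hlog : Real.log n ≤ H := log_le_sum_inv hn
  linarith
end

section
/- There exists a constant C > 0 such that for every integer n ≥ 2 there exists a deterministic online sorting strategy s for array size n whose expected cost over an i.i.d. uniform input satisfies E_x[cost(s,x)] ≤ C · (log n) · 2^{C · log* n}. -/
open MeasureTheory

/-- `logStar n`: the least `k ≥ 0` such that the `k`-fold iteration of the base-2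
logarithm applied to `n` yields a value `≤ 1`. -/
noncomputable def logStar (n : ℕ) : ℕ := sInf {k : ℕ | (Real.logb 2)^[k] n ≤ 1}

/-- The slot chosen by linear probing from `a` in an array of `M` slots with occupied set `O`:
the first free slot to the right of `a`, or the first free slot overall if there is none. -/
noncomputable def probe (M : ℕ) (O : Finset ℕ) (a : ℕ) : ℕ :=
  open Classical in
  if h : ∃ s, a ≤ s ∧ s < M ∧ s ∉ O then Nat.find h else sInf {s | s ∉ O}

/-- `σ` places the items of `T`, with preferred slots `a`, into distinct slots among `M`, such that
every slot that stays free could not have been a better choice for linear probing. -/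
structure IsParking {ι : Type*} (M : ℕ) (T : Finset ι) (a σ : ι → ℕ) : Prop where
  lt : ∀ t ∈ T, σ t < M
  inj : Set.InjOn σ T
  right : ∀ t ∈ T, ∀ s < M, s ∉ T.image σ → a t ≤ s → σ t ≤ s
  left : ∀ t ∈ T, ∀ s < M, s ∉ T.image σ → σ t < a t → s < a t ∧ σ t < s

lemma exists_free {M : ℕ} {O : Finset ℕ} (h : O.card < M) : ∃ s < M, s ∉ O := by
  obtain ⟨s, hs, hs'⟩ := Finset.exists_mem_notMem_of_card_lt_card
    (s := O) (t := Finset.range M) (by simpa using h)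
  exact ⟨s, Finset.mem_range.1 hs, hs'⟩

lemma probe_spec {M : ℕ} {O : Finset ℕ} (h : O.card < M) (a : ℕ) :
    probe M O a < M ∧ probe M O a ∉ O ∧
      (∀ s < M, s ∉ O → a ≤ s → probe M O a ≤ s) ∧
      (∀ s < M, s ∉ O → probe M O a < a → s < a ∧ probe M O a ≤ s) := by
  classical
  unfold probe
  split_ifs with hex
  · have hs := Nat.find_spec hex
    refine ⟨hs.2.1, hs.2.2, fun s hs1 hs2 hs3 => Nat.find_min' hex ⟨hs3, hs1, hs2⟩, ?_⟩
    intro s _ _ hlt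
    exact absurd hs.1 (not_le.2 hlt)
  · obtain ⟨s₀, h1, h2⟩ := exists_free h
    have hmem : sInf {s | s ∉ O} ∈ {s | s ∉ O} := Nat.sInf_mem ⟨s₀, h2⟩
    refine ⟨(Nat.sInf_le h2).trans_lt h1, hmem, fun s hs1 hs2 hs3 => absurd ⟨s, hs3, hs1, hs2⟩ hex,
      fun s hs1 hs2 _ => ⟨?_, Nat.sInf_le hs2⟩⟩
    by_contra hs3
    exact hex ⟨s, not_lt.1 hs3, hs1, hs2⟩

lemma IsParking.congr {ι : Type*} {M : ℕ} {T : Finset ι} {a σ σ' : ι → ℕ}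
    (h : IsParking M T a σ) (hσ : ∀ t ∈ T, σ t = σ' t) : IsParking M T a σ' := by
  have him : T.image σ = T.image σ' := Finset.image_congr fun t ht => hσ t ht
  refine ⟨fun t ht => hσ t ht ▸ h.lt t ht, ?_, ?_, ?_⟩
  · intro t ht u hu htu
    exact h.inj ht hu (by rw [hσ t ht, hσ u hu, htu])
  · intro t ht s hs hs'
    rw [← hσ t ht]
    exact h.right t ht s hs (him ▸ hs')
  · intro t ht s hs hs'
    rw [← hσ t ht]
    exact h.left t ht s hs (him ▸ hs')

lemma IsParking.insert {ι : Type*} [DecidableEq ι] {M : ℕ} {T : Finset ι} {a σ : ι → ℕ}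
    (h : IsParking M T a σ) {t : ι} (ht : t ∉ T) (hcard : T.card < M)
    (hσ : σ t = probe M (T.image σ) (a t)) : IsParking M (insert t T) a σ := by
  obtain ⟨h1, h2, h3, h4⟩ := probe_spec (Finset.card_image_le.trans_lt hcard : (T.image σ).card < M)
    (a t)
  rw [← hσ] at h1 h2 h3 h4
  refine ⟨?_, ?_, ?_, ?_⟩
  · intro u hu
    rcases Finset.mem_insert.1 hu with rfl | hu
    exacts [h1, h.lt u hu]
  · rw [Finset.coe_insert, Set.injOn_insert (by simpa using ht)]
    exact ⟨h.inj, by simpa using h2⟩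
  · intro u hu s hs hs'
    rw [Finset.image_insert, Finset.mem_insert, not_or] at hs'
    rcases Finset.mem_insert.1 hu with rfl | hu
    exacts [h3 s hs hs'.2, h.right u hu s hs hs'.2]
  · intro u hu s hs hs'
    rw [Finset.image_insert, Finset.mem_insert, not_or] at hs'
    rcases Finset.mem_insert.1 hu with rfl | hu
    · intro hlt
      have := h4 s hs hs'.2 hlt
      exact ⟨this.1, lt_of_le_of_ne this.2 (Ne.symm hs'.1)⟩
    · exact h.left u hu s hs hs'.2

lemma exists_isParking {ι : Type*} [DecidableEq ι] (M : ℕ) (T : Finset ι) (a : ι → ℕ)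
    (hT : T.card ≤ M) : ∃ σ, IsParking M T a σ := by
  induction T using Finset.induction_on with
  | empty => exact ⟨a, by constructor <;> simp⟩
  | insert t T ht ih =>
    rw [Finset.card_insert_of_notMem ht] at hT
    obtain ⟨σ, hσ⟩ := ih (by omega)
    have hne : ∀ u ∈ T, σ u = Function.update σ t (probe M (T.image σ) (a t)) u := by
      intro u hu
      rw [Function.update_of_ne (by rintro rfl; exact ht hu)]
    refine ⟨Function.update σ t (probe M (T.image σ) (a t)), (hσ.congr hne).insert ht (by omega) ?_⟩
    rw [Function.update_self]
    exact congrArg (fun O => probe M O (a t)) (Finset.image_congr fun u hu => hne u hu)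

namespace IsParking

variable {ι : Type*} {M : ℕ} {T : Finset ι} {a σ : ι → ℕ}

/-- The number of items whose preferred slot lies in `[q, p]`. -/
def load (T : Finset ι) (a : ι → ℕ) (q p : ℕ) : ℕ := (T.filter fun t => q ≤ a t ∧ a t ≤ p).card

lemma exists_full (h : IsParking M T a σ) {p : ℕ} (hp : p < M) :
    ∃ q ≤ p + 1, Finset.Icc q p ⊆ T.image σ ∧ (∀ t ∈ T, a t < q → σ t < q) ∧
      (q = 0 ∨ q - 1 ∉ T.image σ) := by
  classical
  by_cases hex : ∃ k ≤ p, p - k ∉ T.image σ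
  · set k := Nat.find hex with hk
    obtain ⟨hk1, hk2⟩ := Nat.find_spec hex
    rw [← hk] at hk1 hk2
    refine ⟨p - k + 1, by omega, ?_, ?_, Or.inr (by simpa using hk2)⟩
    · intro s hs
      rw [Finset.mem_Icc] at hs
      by_contra hs'
      have := Nat.find_min hex (m := p - s) (by omega)
      exact this ⟨by omega, by rwa [Nat.sub_sub_self hs.2]⟩
    · intro t ht hat
      have := h.right t ht (p - k) (by omega) hk2 (by omega)
      omega
  · push Not at hex
    refine ⟨0, by omega, ?_, by simp, Or.inl rfl⟩
    intro s hs
    rw [Finset.mem_Icc] at hs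
    simpa [Nat.sub_sub_self hs.2] using hex (p - s) (by omega)

lemma card_full (h : IsParking M T a σ) {q p : ℕ} (hq : Finset.Icc q p ⊆ T.image σ) :
    (T.filter fun t => q ≤ σ t ∧ σ t ≤ p).card = p + 1 - q := by
  rw [← Nat.card_Icc, ← Finset.card_image_of_injOn (h.inj.mono (Finset.filter_subset _ _))]
  congr 1
  ext s
  simp only [Finset.mem_image, Finset.mem_filter, Finset.mem_Icc]
  constructor
  · rintro ⟨t, ⟨_, h2⟩, rfl⟩
    exact h2
  · intro hs
    obtain ⟨t, ht, rfl⟩ := Finset.mem_image.1 (hq (Finset.mem_Icc.2 hs))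
    exact ⟨t, ⟨ht, hs⟩, rfl⟩

/-- The number of items that are moved to the left. -/
lemma card_left (h : IsParking M T a σ) (ha : ∀ t ∈ T, a t < M) (hT : T.card < M) :
    ∃ q ≤ M, (T.filter fun t => σ t < a t).card + (M - q) ≤ load T a q (M - 1) := by
  classical
  obtain ⟨q, hq, hfull, hstay, hfree⟩ := h.exists_full (p := M - 1) (by omega)
  have hfree : 0 < q ∧ q - 1 ∉ T.image σ := by
    rcases hfree with rfl | hfree
    · exfalso
      have := (Finset.card_le_card hfull).trans Finset.card_image_le
      rw [Nat.card_Icc] at this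
      omega
    · rcases Nat.eq_zero_or_pos q with rfl | h0
      · exfalso
        have := (Finset.card_le_card hfull).trans Finset.card_image_le
        rw [Nat.card_Icc] at this
        omega
      · exact ⟨h0, hfree⟩
  refine ⟨q, by omega, ?_⟩
  have hdisj : Disjoint (T.filter fun t => σ t < a t)
      (T.filter fun t => q ≤ σ t ∧ σ t ≤ M - 1) := by
    rw [Finset.disjoint_filter]
    intro t ht hlt hq'
    have := h.left t ht (q - 1) (by omega) hfree.2 hlt
    omega
  have hc := h.card_full hfull
  rw [show M - q = M - 1 + 1 - q by omega, ← hc, ← Finset.card_union_of_disjoint hdisj]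
  refine Finset.card_le_card fun t ht => ?_
  simp only [Finset.mem_union, Finset.mem_filter] at ht ⊢
  have htT : t ∈ T := by tauto
  refine ⟨htT, ?_, by have := ha t htT; omega⟩
  rcases ht with ⟨_, ht⟩ | ⟨_, ht⟩
  · have := h.left t htT (q - 1) (by omega) hfree.2 ht
    omega
  · by_contra hlt
    have := hstay t htT (not_le.1 hlt)
    omega

/-- The number of items that are moved across `p` to the right. -/
lemma card_cross (h : IsParking M T a σ) {p : ℕ} (hp : p < M) :
    ∃ q ≤ p + 1, (T.filter fun t => a t ≤ p ∧ p < σ t).card + (p + 1 - q) ≤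
      load T a q p + (T.filter fun t => σ t < a t).card := by
  classical
  obtain ⟨q, hq, hfull, hstay, -⟩ := h.exists_full hp
  refine ⟨q, hq, ?_⟩
  have hdisj : Disjoint (T.filter fun t => a t ≤ p ∧ p < σ t)
      (T.filter fun t => q ≤ σ t ∧ σ t ≤ p) := by
    rw [Finset.disjoint_filter]
    intro t _ _ _
    omega
  rw [← h.card_full hfull, ← Finset.card_union_of_disjoint hdisj, load]
  refine (Finset.card_le_card fun t ht => ?_).trans (Finset.card_union_le _ _)
  simp only [Finset.mem_union, Finset.mem_filter] at ht ⊢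
  have htT : t ∈ T := by tauto
  have := hstay t htT
  rcases ht with ⟨_, ht⟩ | ⟨_, ht⟩
  · exact Or.inl ⟨htT, by omega⟩
  · by_cases hlt : σ t < a t
    · exact Or.inr ⟨htT, hlt⟩
    · exact Or.inl ⟨htT, by omega⟩

variable {w : ℕ → ℝ}

lemma card_left_le (h : IsParking M T a σ) (ha : ∀ t ∈ T, a t < M) (hT : T.card < M)
    (hw : ∀ p < M, ∀ q ≤ p + 1, (load T a q p : ℝ) - (p + 1 - q) ≤ w p) :
    ((T.filter fun t => σ t < a t).card : ℝ) ≤ w (M - 1) := by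
  obtain ⟨q, hq, hle⟩ := h.card_left ha hT
  have h1 := hw (M - 1) (by omega) q (by omega)
  have h2 : ((T.filter fun t => σ t < a t).card : ℝ) + (M - q) ≤ load T a q (M - 1) := by
    rw [← Nat.cast_sub hq]
    exact_mod_cast hle
  have h3 : ((M - 1 : ℕ) : ℝ) + 1 = M := by
    have : M - 1 + 1 = M := by omega
    exact_mod_cast this
  rw [h3] at h1
  linarith

lemma card_cross_le (h : IsParking M T a σ) (ha : ∀ t ∈ T, a t < M) (hT : T.card < M)
    (hw : ∀ p < M, ∀ q ≤ p + 1, (load T a q p : ℝ) - (p + 1 - q) ≤ w p) {p : ℕ} (hp : p < M) :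
    ((T.filter fun t => a t ≤ p ∧ p < σ t).card : ℝ) ≤ w p + w (M - 1) := by
  obtain ⟨q, hq, hle⟩ := h.card_cross hp
  have h1 := hw p hp q hq
  have h2 : ((T.filter fun t => a t ≤ p ∧ p < σ t).card : ℝ) + (p + 1 - q) ≤
      load T a q p + (T.filter fun t => σ t < a t).card := by
    have : ((p + 1 - q : ℕ) : ℝ) = p + 1 - q := by rw [Nat.cast_sub hq]; push_cast; ring
    rw [← this]
    exact_mod_cast hle
  have := h.card_left_le ha hT hw
  linarith

/-- The total displacement of a parking. -/
lemma sum_dist_le (h : IsParking M T a σ) (ha : ∀ t ∈ T, a t < M) (hT : T.card < M)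
    (hw : ∀ p < M, ∀ q ≤ p + 1, (load T a q p : ℝ) - (p + 1 - q) ≤ w p) :
    ∑ t ∈ T, |(σ t : ℝ) - a t| ≤ ∑ p ∈ Finset.range M, w p + 2 * M * w (M - 1) := by
  have hpt : ∀ t ∈ T, |(σ t : ℝ) - a t| ≤
      (∑ p ∈ Finset.range M, if a t ≤ p ∧ p < σ t then (1 : ℝ) else 0) +
        (if σ t < a t then (M : ℝ) else 0) := by
    intro t ht
    have h1 := h.lt t ht
    have h2 := ha t ht
    split_ifs with hlt
    · have hnn : (0 : ℝ) ≤ ∑ p ∈ Finset.range M, if a t ≤ p ∧ p < σ t then (1 : ℝ) else 0 :=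
        Finset.sum_nonneg fun p _ => by split_ifs <;> norm_num
      have : |(σ t : ℝ) - a t| ≤ M := by
        rw [abs_le]
        have e1 : (σ t : ℝ) < M := by exact_mod_cast h1
        have e2 : (a t : ℝ) < M := by exact_mod_cast h2
        have e3 : (0 : ℝ) ≤ σ t := by positivity
        have e4 : (0 : ℝ) ≤ a t := by positivity
        constructor <;> linarith
      linarith
    · rw [← Finset.sum_filter, Finset.sum_const, add_zero, nsmul_eq_mul, mul_one]
      have : (Finset.range M).filter (fun p => a t ≤ p ∧ p < σ t) = Finset.Ico (a t) (σ t) := by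
        ext p
        simp only [Finset.mem_filter, Finset.mem_range, Finset.mem_Ico]
        omega
      rw [this, Nat.card_Ico, Nat.cast_sub (not_lt.1 hlt), abs_of_nonneg]
      exact sub_nonneg.2 (by exact_mod_cast not_lt.1 hlt)
  refine (Finset.sum_le_sum hpt).trans ?_
  rw [Finset.sum_add_distrib, Finset.sum_comm]
  have h1 : ∑ p ∈ Finset.range M, ∑ t ∈ T, (if a t ≤ p ∧ p < σ t then (1 : ℝ) else 0) ≤
      ∑ p ∈ Finset.range M, (w p + w (M - 1)) := by
    refine Finset.sum_le_sum fun p hp => ?_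
    rw [← Finset.sum_filter, Finset.sum_const, nsmul_eq_mul, mul_one]
    exact h.card_cross_le ha hT hw (Finset.mem_range.1 hp)
  have h2 : ∑ t ∈ T, (if σ t < a t then (M : ℝ) else 0) ≤ M * w (M - 1) := by
    rw [← Finset.sum_filter, Finset.sum_const, nsmul_eq_mul, mul_comm]
    exact mul_le_mul_of_nonneg_left (h.card_left_le ha hT hw) (Nat.cast_nonneg _)
  rw [Finset.sum_add_distrib, Finset.sum_const, Finset.card_range, nsmul_eq_mul] at h1
  linarith

/-- The number of slots in `[A, B]` that stay free. -/
lemma card_free_le (h : IsParking M T a σ) (ha : ∀ t ∈ T, a t < M) (hT : T.card < M)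
    (hw : ∀ p < M, ∀ q ≤ p + 1, (load T a q p : ℝ) - (p + 1 - q) ≤ w p) {A B : ℕ}
    (hB : B < M) (hAB : A ≤ B + 1) :
    (((Finset.Icc A B).filter fun s => s ∉ T.image σ).card : ℝ) ≤
      (B + 1 - A) - load T a A B + w B + 2 * w (M - 1) := by
  classical
  have hsub : T.filter (fun t => A ≤ a t ∧ a t ≤ B) ⊆
      T.filter (fun t => A ≤ σ t ∧ σ t ≤ B) ∪ ((T.filter fun t => a t ≤ B ∧ B < σ t) ∪
        (T.filter fun t => σ t < a t)) := by
    intro t ht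
    simp only [Finset.mem_union, Finset.mem_filter] at ht ⊢
    refine (lt_or_ge (σ t) (a t)).elim (fun hlt => Or.inr (Or.inr ⟨ht.1, hlt⟩)) fun hge => ?_
    refine (lt_or_ge B (σ t)).elim (fun hlt => Or.inr (Or.inl ⟨ht.1, ht.2.2, hlt⟩)) fun hge' => ?_
    exact Or.inl ⟨ht.1, by omega, hge'⟩
  have h1 := (Finset.card_le_card hsub).trans ((Finset.card_union_le _ _).trans
    (Nat.add_le_add_left (Finset.card_union_le _ _) _))
  have h2 : (T.filter fun t => A ≤ σ t ∧ σ t ≤ B).card ≤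
      ((Finset.Icc A B).filter fun s => s ∈ T.image σ).card := by
    rw [← Finset.card_image_of_injOn (h.inj.mono (Finset.filter_subset _ _))]
    refine Finset.card_le_card fun s hs => ?_
    obtain ⟨t, ht, rfl⟩ := Finset.mem_image.1 hs
    rw [Finset.mem_filter] at ht ⊢
    exact ⟨Finset.mem_Icc.2 ht.2, Finset.mem_image_of_mem _ ht.1⟩
  have h3 := Finset.card_filter_add_card_filter_not (s := Finset.Icc A B) (fun s => s ∈ T.image σ)
  rw [Nat.card_Icc] at h3
  have h4 := h.card_cross_le ha hT hw hB
  have h5 := h.card_left_le ha hT hw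
  have h6 : (((Finset.Icc A B).filter fun s => s ∉ T.image σ).card : ℝ) + load T a A B ≤
      (B + 1 - A) + (T.filter fun t => a t ≤ B ∧ B < σ t).card +
        (T.filter fun t => σ t < a t).card := by
    have : ((B + 1 - A : ℕ) : ℝ) = B + 1 - A := by rw [Nat.cast_sub hAB]; push_cast; ring
    rw [← this]
    norm_cast
    unfold load
    omega
  linarith

end IsParking

/-- The set of slots occupied after linear probing with the first `k` preferences of `a`. -/
noncomputable def parkOcc (M : ℕ) (a : ℕ → ℕ) : ℕ → Finset ℕ
  | 0 => ∅
  | k + 1 => insert (probe M (parkOcc M a k) (a k)) (parkOcc M a k)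

/-- The slot that linear probing assigns to the `k`-th item. -/
noncomputable def parkSlot (M : ℕ) (a : ℕ → ℕ) (k : ℕ) : ℕ := probe M (parkOcc M a k) (a k)

lemma parkOcc_congr {M : ℕ} {a b : ℕ → ℕ} {k : ℕ} (h : ∀ i < k, a i = b i) :
    parkOcc M a k = parkOcc M b k := by
  induction k with
  | zero => rfl
  | succ k ih => rw [parkOcc, parkOcc, ih fun i hi => h i (by omega), h k (by omega)]

lemma parkSlot_congr {M : ℕ} {a b : ℕ → ℕ} {k : ℕ} (h : ∀ i ≤ k, a i = b i) :
    parkSlot M a k = parkSlot M b k := by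
  rw [parkSlot, parkSlot, parkOcc_congr fun i hi => h i (by omega), h k le_rfl]

lemma parkOcc_eq_image (M : ℕ) (a : ℕ → ℕ) (k : ℕ) :
    parkOcc M a k = (Finset.range k).image (parkSlot M a) := by
  induction k with
  | zero => rfl
  | succ k ih =>
    rw [Finset.range_add_one, Finset.image_insert, ← ih]
    rfl

lemma isParking_parkSlot {M h : ℕ} (a : ℕ → ℕ) (hM : h ≤ M) :
    IsParking M (Finset.range h) a (parkSlot M a) := by
  induction h with
  | zero => constructor <;> simp
  | succ h ih =>
    rw [Finset.range_add_one]
    refine (ih (by omega)).insert (by simp) (by simpa using hM) ?_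
    rw [← parkOcc_eq_image, parkSlot]

lemma parkOcc_subset {M h : ℕ} (a : ℕ → ℕ) (hM : h ≤ M) : parkOcc M a h ⊆ Finset.range M := by
  rw [parkOcc_eq_image]
  intro s hs
  obtain ⟨t, ht, rfl⟩ := Finset.mem_image.1 hs
  exact Finset.mem_range.2 ((isParking_parkSlot a hM).lt t ht)

lemma card_parkOcc {M h : ℕ} (a : ℕ → ℕ) (hM : h ≤ M) : (parkOcc M a h).card = h := by
  rw [parkOcc_eq_image, Finset.card_image_of_injOn (isParking_parkSlot a hM).inj,
    Finset.card_range]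

section

open IsParking

/-- An upper bound for the number of items that linear probing moves across `p`. -/
noncomputable def surplus (h : ℕ) (y : ℕ → ℕ) (p : ℕ) : ℝ :=
  ∑ q ∈ Finset.range (p + 1), 10 * Real.exp (((load (Finset.range h) y q p : ℝ) - (p + 1 - q)) / 10)

/-- An upper bound for the excess of slots in `[2q, 2p+1]` that stay free over the `p + 1 - q`
slots that replace them in an array of half the size. -/
noncomputable def deficit (h : ℕ) (y : ℕ → ℕ) (p : ℕ) : ℝ :=
  ∑ q ∈ Finset.range (p + 1),
    10 * Real.exp (((p + 1 - q) - (load (Finset.range h) y (2 * q) (2 * p + 1) : ℝ)) / 10)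

/-- The surplus of the free slots when they are moved to an array of `M` slots. -/
noncomputable def freeSurplus (M h : ℕ) (y : ℕ → ℕ) (p : ℕ) : ℝ :=
  surplus h y (2 * p + 1) + 2 * surplus h y (2 * M - 1) + deficit h y p

/-- The normalized displacement in an array of `M` slots, in terms of crossing bounds `w`. -/
noncomputable def displacement (M : ℕ) (w : ℕ → ℝ) : ℝ :=
  (∑ p ∈ Finset.range M, w p) / M + 2 * w (M - 1)

lemma le_ten_exp (z : ℝ) : z ≤ 10 * Real.exp (z / 10) := by
  have := Real.add_one_le_exp (z / 10)
  linarith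

lemma surplus_nonneg (h : ℕ) (y : ℕ → ℕ) (p : ℕ) : 0 ≤ surplus h y p :=
  Finset.sum_nonneg fun _ _ => by positivity

lemma deficit_nonneg (h : ℕ) (y : ℕ → ℕ) (p : ℕ) : 0 ≤ deficit h y p :=
  Finset.sum_nonneg fun _ _ => by positivity

lemma load_le_surplus (h : ℕ) (y : ℕ → ℕ) (p q : ℕ) (hq : q ≤ p + 1) :
    (load (Finset.range h) y q p : ℝ) - (p + 1 - q) ≤ surplus h y p := by
  rcases hq.eq_or_lt with rfl | hq
  · have : load (Finset.range h) y (p + 1) p = 0 := by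
      rw [load, Finset.card_eq_zero, Finset.filter_eq_empty_iff]
      intros
      omega
    rw [this]
    simpa using surplus_nonneg h y p
  · exact (le_ten_exp _).trans (Finset.single_le_sum
      (f := fun q : ℕ => 10 * Real.exp (((load (Finset.range h) y q p : ℝ) - (p + 1 - q)) / 10))
      (fun _ _ => by positivity) (Finset.mem_range.2 hq))

lemma le_deficit (h : ℕ) (y : ℕ → ℕ) (p q : ℕ) (hq : q ≤ p + 1) :
    (p + 1 - q) - (load (Finset.range h) y (2 * q) (2 * p + 1) : ℝ) ≤ deficit h y p := by
  rcases hq.eq_or_lt with rfl | hq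
  · have : (0 : ℝ) ≤ load (Finset.range h) y (2 * (p + 1)) (2 * p + 1) := Nat.cast_nonneg _
    have := deficit_nonneg h y p
    push_cast
    linarith
  · exact (le_ten_exp _).trans (Finset.single_le_sum
      (f := fun q : ℕ => 10 *
        Real.exp (((p + 1 - q) - (load (Finset.range h) y (2 * q) (2 * p + 1) : ℝ)) / 10))
      (fun _ _ => by positivity) (Finset.mem_range.2 hq))

lemma sum_parkSlot_le {M h : ℕ} {y : ℕ → ℕ} (hy : ∀ i, y i < M) (hM : h < M) :
    ∑ k ∈ Finset.range h, |(parkSlot M y k : ℝ) / M - y k / M| ≤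
      displacement M (surplus h y) := by
  have hM0 : (0 : ℝ) < M := by exact_mod_cast (by omega : 0 < M)
  have := (isParking_parkSlot y hM.le).sum_dist_le (fun t _ => hy t) (by simpa using hM)
    (w := surplus h y) (fun p _ q hq => load_le_surplus h y p q hq)
  have e : ∀ k, |(parkSlot M y k : ℝ) / M - y k / M| = |(parkSlot M y k : ℝ) - y k| / M := by
    intro k
    rw [← sub_div, abs_div, abs_of_pos hM0]
  rw [Finset.sum_congr rfl fun k _ => e k, ← Finset.sum_div, div_le_iff₀ hM0, displacement]
  refine this.trans (le_of_eq ?_)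
  field_simp

lemma sum_free_le {M h : ℕ} {y : ℕ → ℕ} (hy : ∀ i, y i < 2 * M) (hM : h < 2 * M) (hh : M < h)
    {τ : ℕ → ℕ} (hτ : IsParking M (Finset.range (2 * M) \ parkOcc (2 * M) y h) (· / 2) τ) :
    ∑ s ∈ Finset.range (2 * M) \ parkOcc (2 * M) y h, |(τ s : ℝ) / M - s / (2 * M : ℕ)| ≤
      displacement M (freeSurplus M h y) + 1 := by
  have hM0 : (0 : ℝ) < M := by exact_mod_cast (by omega : 0 < M)
  set T := Finset.range (2 * M) \ parkOcc (2 * M) y h with hT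
  have hcard : T.card = 2 * M - h := by
    rw [hT, Finset.card_sdiff_of_subset (parkOcc_subset y hM.le), card_parkOcc y hM.le,
      Finset.card_range]
  have hT2 : ∀ t ∈ T, t < 2 * M := fun t ht => Finset.mem_range.1 (Finset.mem_sdiff.1 ht).1
  have hw : ∀ p < M, ∀ q ≤ p + 1, (load T (· / 2) q p : ℝ) - (p + 1 - q) ≤
      freeSurplus M h y p := by
    intro p hp q hq
    have h1 := (isParking_parkSlot y hM.le).card_free_le (fun t _ => hy t) (by simpa using hM)
      (w := surplus h y) (fun p _ q hq => load_le_surplus h y p q hq)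
      (A := 2 * q) (B := 2 * p + 1) (by omega) (by omega)
    rw [← parkOcc_eq_image] at h1
    have h2 : load T (· / 2) q p ≤
        ((Finset.Icc (2 * q) (2 * p + 1)).filter fun s => s ∉ parkOcc (2 * M) y h).card := by
      refine Finset.card_le_card fun s hs => ?_
      simp only [hT, Finset.mem_filter, Finset.mem_sdiff, Finset.mem_Icc] at hs ⊢
      exact ⟨by omega, hs.1.2⟩
    have h2 : (load T (· / 2) q p : ℝ) ≤
        ((Finset.Icc (2 * q) (2 * p + 1)).filter fun s => s ∉ parkOcc (2 * M) y h).card := by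
      exact_mod_cast h2
    have h3 := le_deficit h y p q hq
    unfold freeSurplus
    push_cast at h1
    linarith
  have hsum := hτ.sum_dist_le (fun t ht => by have := hT2 t ht; show t / 2 < M; omega)
    (by omega) hw
  have hpt : ∀ s ∈ T, |(τ s : ℝ) / M - s / (2 * M : ℕ)| ≤
      |(τ s : ℝ) - (s / 2 : ℕ)| / M + 1 / (2 * M) := by
    intro s _
    have e : (τ s : ℝ) / M - s / (2 * M : ℕ) =
        ((τ s : ℝ) - (s / 2 : ℕ)) / M - (s % 2 : ℕ) / (2 * M) := by
      have : (s : ℝ) = 2 * (s / 2 : ℕ) + (s % 2 : ℕ) := by exact_mod_cast (Nat.div_add_mod s 2).symm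
      rw [this]
      push_cast
      field_simp
      ring
    rw [e]
    refine (abs_sub _ _).trans (add_le_add ?_ ?_)
    · rw [abs_div, abs_of_pos hM0]
    · rw [abs_of_nonneg (by positivity)]
      have : ((s % 2 : ℕ) : ℝ) ≤ 1 := by exact_mod_cast (by omega : s % 2 ≤ 1)
      gcongr
  refine (Finset.sum_le_sum hpt).trans ?_
  rw [Finset.sum_add_distrib, Finset.sum_const, hcard, ← Finset.sum_div, nsmul_eq_mul]
  have h1 : (∑ t ∈ T, |(τ t : ℝ) - (t / 2 : ℕ)|) / M ≤ displacement M (freeSurplus M h y) := by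
    rw [div_le_iff₀ hM0, displacement]
    refine hsum.trans (le_of_eq ?_)
    field_simp
  have h2 : ((2 * M - h : ℕ) : ℝ) * (1 / (2 * M)) ≤ 1 := by
    rw [mul_one_div, div_le_one (by positivity)]
    exact_mod_cast Nat.sub_le _ _
  linarith

end

/-- In an array with `r` empty cells, of which `M` are labelled by `0, 1/M, …, (M-1)/M` and lie to
the left of the other ones, which form a block, `r` items from `{0, 1/M, …, (M-1)/M}` can be placed
online, with total distance between items and labels at most `cost`, where the cells of
the block are labelled a posteriori with total variation at most `tv`. -/
def Placeable (M r : ℕ) (cost : (ℕ → ℕ) → ℝ) (tv : ℝ) : Prop :=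
  ∀ (b : ℕ) (c : ℕ → ℕ), Set.InjOn c (Finset.range M) → (∀ s < M, c s < b) →
    ∃ (f : (ℕ → ℕ) → ℕ → ℕ) (p : (ℕ → ℕ) → ℕ → ℝ),
      (∀ y z k, (∀ i ≤ k, y i = z i) → f y k = f z k) ∧
      ∀ y, (∀ i, y i < M) →
        Set.InjOn (f y) (Finset.range r) ∧
        (∀ k < r, (∃ s < M, f y k = c s) ∨ (b ≤ f y k ∧ f y k < b + (r - M))) ∧
        (∀ j, 0 ≤ p y j ∧ p y j ≤ 1) ∧
        (∀ s < M, p y (c s) = s / M) ∧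
        ∑ j ∈ Finset.Ico b (b + (r - M)), |p y (j + 1) - p y j| ≤ tv ∧
        ∑ k ∈ Finset.range r, |(y k : ℝ) / M - p y (f y k)| ≤ cost y

lemma exists_label {M : ℕ} {c : ℕ → ℕ} (hc : Set.InjOn c (Finset.range M)) :
    ∃ l : ℕ → ℝ, (∀ j, 0 ≤ l j ∧ l j ≤ 1) ∧ (∀ s < M, l (c s) = s / M) ∧
      ∀ j, (∀ s < M, c s ≠ j) → l j = 0 := by
  classical
  refine ⟨fun j => if h : ∃ s < M, c s = j then (h.choose : ℝ) / M else 0, ?_, ?_, ?_⟩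
  · intro j
    dsimp only
    split_ifs with h
    · have := h.choose_spec.1
      exact ⟨by positivity, div_le_one_of_le₀ (by exact_mod_cast this.le) (Nat.cast_nonneg _)⟩
    · norm_num
  · intro s hs
    have h : ∃ s' < M, c s' = c s := ⟨s, hs, rfl⟩
    dsimp only
    rw [dif_pos h, hc (by simpa using h.choose_spec.1) (by simpa using hs) h.choose_spec.2]
  · intro j hj
    dsimp only
    rw [dif_neg]
    rintro ⟨s, hs, h⟩
    exact hj s hs h

lemma placeable_base {M r : ℕ} (hM : M ≤ r) : Placeable M r (fun _ => r) 0 := by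
  intro b c hc hb
  obtain ⟨l, hl1, hl2, hl3⟩ := exists_label hc
  refine ⟨fun _ k => if k < M then c k else b + (k - M), fun _ => l, fun _ _ _ _ => rfl, ?_⟩
  intro y hy
  refine ⟨?_, ?_, hl1, hl2, ?_, ?_⟩
  · intro k₁ h₁ k₂ h₂ h
    dsimp only at h
    split_ifs at h with h3 h4 h4
    · exact hc (by simpa using h3) (by simpa using h4) h
    · have := hb k₁ h3
      omega
    · have := hb k₂ h4
      omega
    · omega
  · intro k hk
    dsimp only
    split_ifs with h
    · exact Or.inl ⟨k, h, rfl⟩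
    · exact Or.inr (by omega)
  · refine (Finset.sum_eq_zero fun j hj => ?_).le
    rw [Finset.mem_Ico] at hj
    dsimp only
    rw [hl3 j fun s hs => by have := hb s hs; omega,
      hl3 (j + 1) fun s hs => by have := hb s hs; omega]
    simp
  · calc _ ≤ ∑ k ∈ Finset.range r, (1 : ℝ) := by
          refine Finset.sum_le_sum fun k _ => ?_
          have h1 := hl1 (if k < M then c k else b + (k - M))
          have h2 : (0 : ℝ) ≤ (y k : ℝ) / M := by positivity
          have h3 : (y k : ℝ) / M ≤ 1 :=
            div_le_one_of_le₀ (by exact_mod_cast (hy k).le) (Nat.cast_nonneg _)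
          rw [abs_le]
          constructor <;> linarith
      _ = r := by simp

/-- The cells labelled by the free slots of an array of `2M` slots are moved to slots in an array
of `M` slots, and the other ones of these are filled with new cells in increasing order. -/
lemma exists_relabel {M h b : ℕ} {O : Finset ℕ} {c : ℕ → ℕ} (hO : O ⊆ Finset.range (2 * M))
    (hcard : O.card = h) (hM : M < h) (hh : h ≤ 2 * M) (hc : Set.InjOn c (Finset.range (2 * M)))
    (hb : ∀ s < 2 * M, c s < b) :
    ∃ τ c' : ℕ → ℕ, IsParking M (Finset.range (2 * M) \ O) (· / 2) τ ∧
      Set.InjOn c' (Finset.range M) ∧ (∀ s < M, c' s < b + (h - M)) ∧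
      (∀ s ∈ Finset.range (2 * M) \ O, c' (τ s) = c s) ∧
      (∀ s < M, (∃ u ∈ Finset.range (2 * M) \ O, c' s = c u) ∨ b ≤ c' s) ∧
      (∀ j, b ≤ j → j < b + (h - M) → ∃ s < M, c' s = j) ∧
      (∀ s < M, ∀ u < M, b ≤ c' s → c' s < c' u → s < u) := by
  classical
  set T := Finset.range (2 * M) \ O with hT
  have hTc : T.card = 2 * M - h := by
    rw [hT, Finset.card_sdiff_of_subset hO, hcard, Finset.card_range]
  have hT2 : ∀ t ∈ T, t < 2 * M := fun t ht => Finset.mem_range.1 (Finset.mem_sdiff.1 ht).1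
  obtain ⟨τ, hτ⟩ := exists_isParking M T (· / 2) (by omega)
  set V := Finset.range M \ T.image τ with hV
  have hVc : V.card = h - M := by
    rw [hV, Finset.card_sdiff_of_subset, Finset.card_range, Finset.card_image_of_injOn hτ.inj, hTc]
    · omega
    · intro s hs
      obtain ⟨t, ht, rfl⟩ := Finset.mem_image.1 hs
      exact Finset.mem_range.2 (hτ.lt t ht)
  let rk : ℕ → ℕ := fun s => (V.filter (· < s)).card
  have hrk : ∀ s ∈ V, rk s < h - M := by
    intro s hs
    rw [← hVc]
    refine Finset.card_lt_card ⟨Finset.filter_subset _ _, fun hsub => ?_⟩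
    simpa using (Finset.mem_filter.1 (hsub hs)).2
  have hmono : ∀ s ∈ V, ∀ u, s < u → rk s < rk u := by
    intro s hs u hsu
    refine Finset.card_lt_card ⟨fun t ht => ?_, fun hsub => ?_⟩
    · rw [Finset.mem_filter] at ht ⊢
      exact ⟨ht.1, ht.2.trans hsu⟩
    · simpa using (Finset.mem_filter.1 (hsub (Finset.mem_filter.2 ⟨hs, hsu⟩))).2
  have hrinj : Set.InjOn rk V := by
    intro s hs u hu hsu
    rcases lt_trichotomy s u with hlt | rfl | hlt
    · exact absurd hsu (hmono s hs u hlt).ne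
    · rfl
    · exact absurd hsu (hmono u hu s hlt).ne'
  have hrsurj : V.image rk = Finset.range (h - M) := by
    refine Finset.eq_of_subset_of_card_le (fun j hj => ?_) ?_
    · obtain ⟨s, hs, rfl⟩ := Finset.mem_image.1 hj
      exact Finset.mem_range.2 (hrk s hs)
    · rw [Finset.card_image_of_injOn hrinj, hVc, Finset.card_range]
  let c' : ℕ → ℕ := fun s => if hs : ∃ t ∈ T, τ t = s then c hs.choose else b + rk s
  have h1 : ∀ t ∈ T, c' (τ t) = c t := by
    intro t ht
    have hs : ∃ u ∈ T, τ u = τ t := ⟨t, ht, rfl⟩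
    have := hτ.inj hs.choose_spec.1 ht hs.choose_spec.2
    simp only [c']
    rw [dif_pos hs, this]
  have h2 : ∀ s ∈ V, c' s = b + rk s := by
    intro s hs
    simp only [c']
    rw [dif_neg]
    rintro ⟨t, ht, rfl⟩
    exact (Finset.mem_sdiff.1 hs).2 (Finset.mem_image_of_mem _ ht)
  have hcase : ∀ s < M, (∃ t ∈ T, τ t = s) ∨ s ∈ V := by
    intro s hs
    by_cases hs' : s ∈ T.image τ
    · exact Or.inl (Finset.mem_image.1 hs')
    · exact Or.inr (Finset.mem_sdiff.2 ⟨Finset.mem_range.2 hs, hs'⟩)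
  refine ⟨τ, c', hτ, ?_, ?_, h1, ?_, ?_, ?_⟩
  · intro s hs u hu hsu
    rcases hcase s (by simpa using hs) with ⟨t, ht, rfl⟩ | hs <;>
    rcases hcase u (by simpa using hu) with ⟨t', ht', rfl⟩ | hu
    · rw [h1 t ht, h1 t' ht'] at hsu
      rw [hc (by simpa using hT2 t ht) (by simpa using hT2 t' ht') hsu]
    · rw [h1 t ht, h2 u hu] at hsu
      have := hb t (hT2 t ht)
      omega
    · rw [h1 t' ht', h2 s hs] at hsu
      have := hb t' (hT2 t' ht')
      omega
    · rw [h2 s hs, h2 u hu] at hsu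
      exact hrinj hs hu (by omega)
  · intro s hs
    rcases hcase s hs with ⟨t, ht, rfl⟩ | hs
    · rw [h1 t ht]
      have := hb t (hT2 t ht)
      omega
    · rw [h2 s hs]
      have := hrk s hs
      omega
  · intro s hs
    rcases hcase s hs with ⟨t, ht, rfl⟩ | hs
    · exact Or.inl ⟨t, ht, h1 t ht⟩
    · rw [h2 s hs]
      exact Or.inr (by omega)
  · intro j hj hj'
    have : j - b ∈ V.image rk := by
      rw [hrsurj, Finset.mem_range]
      omega
    obtain ⟨s, hs, hsj⟩ := Finset.mem_image.1 this
    refine ⟨s, Finset.mem_range.1 (Finset.mem_sdiff.1 hs).1, ?_⟩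
    rw [h2 s hs]
    omega
  · intro s hs u hu hbs hsu
    rcases hcase s hs with ⟨t, ht, rfl⟩ | hs
    · rw [h1 t ht] at hbs
      exact absurd (hb t (hT2 t ht)) (not_lt.2 hbs)
    rcases hcase u hu with ⟨t, ht, rfl⟩ | hu
    · rw [h1 t ht] at hsu
      have := hb t (hT2 t ht)
      omega
    · rw [h2 s hs, h2 u hu] at hsu
      by_contra hus
      rcases (not_lt.1 hus).eq_or_lt with rfl | hlt
      · exact lt_irrefl _ hsu
      · have := hmono u hu s hlt
        omega

lemma sum_abs_sub_le_of_monotoneOn {g : ℕ → ℝ} {b e : ℕ} (hg : MonotoneOn g (Set.Ico b e))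
    (h01 : ∀ j, 0 ≤ g j ∧ g j ≤ 1) : ∑ j ∈ Finset.Ico b e, |g (j + 1) - g j| ≤ 2 := by
  rcases Nat.lt_or_ge b e with hbe | hbe
  · obtain ⟨e, rfl⟩ : ∃ e', e = e' + 1 := ⟨e - 1, by omega⟩
    rw [Finset.sum_Ico_succ_top (by omega)]
    have h1 : ∑ j ∈ Finset.Ico b e, |g (j + 1) - g j| = g e - g b := by
      rw [← Finset.sum_Ico_sub g (by omega)]
      refine Finset.sum_congr rfl fun j hj => abs_of_nonneg (sub_nonneg.2 ?_)
      rw [Finset.mem_Ico] at hj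
      exact hg ⟨hj.1, by omega⟩ ⟨by omega, by omega⟩ (by omega)
    have h2 : |g (e + 1) - g e| ≤ 1 := by
      rw [abs_le]
      constructor <;> linarith [h01 e, h01 (e + 1)]
    linarith [h01 e, h01 b]
  · rw [Finset.Ico_eq_empty (by omega)]
    norm_num

/-- The cost of a phase that places `h` items in an array of `2M` slots and moves the slots that
stay free to an array of `M` slots. -/
noncomputable def phaseCost (M h : ℕ) (y : ℕ → ℕ) : ℝ :=
  displacement (2 * M) (surplus h y) + displacement M (freeSurplus M h y) + 2

lemma placeable_step {M r r' h : ℕ} {cost : (ℕ → ℕ) → ℝ} {tv : ℝ}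
    (H : Placeable M r' cost tv) (hr : r = h + r') (hM : M < h) (hh : h < 2 * M) (hr' : M ≤ r')
    (hr2 : r' ≤ 2 * M) :
    Placeable (2 * M) r (fun y => phaseCost M h y + cost fun i => y (i + h) / 2) (tv + 2) := by
  classical
  intro b c hc hb
  have key : ∀ O : Finset ℕ, ∃ (f : (ℕ → ℕ) → ℕ → ℕ) (p : (ℕ → ℕ) → ℕ → ℝ),
      (∀ y z k, (∀ i ≤ k, y i = z i) → f y k = f z k) ∧
      (O ⊆ Finset.range (2 * M) → O.card = h → ∀ y, (∀ i, y i < M) →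
        Set.InjOn (f y) (Finset.range r') ∧
        (∀ k < r', (∃ s ∈ Finset.range (2 * M) \ O, f y k = c s) ∨
          (b ≤ f y k ∧ f y k < b + (r - 2 * M))) ∧
        (∀ j, 0 ≤ p y j ∧ p y j ≤ 1) ∧
        (∃ τ, IsParking M (Finset.range (2 * M) \ O) (· / 2) τ ∧
          ∀ s ∈ Finset.range (2 * M) \ O, p y (c s) = τ s / M) ∧
        ∑ j ∈ Finset.Ico b (b + (r - 2 * M)), |p y (j + 1) - p y j| ≤ tv + 2 ∧
        ∑ k ∈ Finset.range r', |(y k : ℝ) / M - p y (f y k)| ≤ cost y) := by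
    intro O
    by_cases hO : O ⊆ Finset.range (2 * M) ∧ O.card = h
    swap
    · exact ⟨fun _ _ => 0, fun _ _ => 0, fun _ _ _ _ => rfl, fun h1 h2 => absurd ⟨h1, h2⟩ hO⟩
    obtain ⟨τ, c', hτ, hc'1, hc'2, hc'3, hc'4, hc'5, hc'6⟩ :=
      exists_relabel hO.1 hO.2 hM hh.le hc hb
    obtain ⟨f, p, hf, hfp⟩ := H (b + (h - M)) c' hc'1 hc'2
    have hend : b + (h - M) + (r' - M) = b + (r - 2 * M) := by omega
    rw [hend] at hfp
    refine ⟨f, p, hf, fun _ _ y hy => ?_⟩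
    obtain ⟨g1, g2, g3, g4, g5, g6⟩ := hfp y hy
    refine ⟨g1, ?_, g3, ⟨τ, hτ, ?_⟩, ?_, g6⟩
    · intro k hk
      rcases g2 k hk with ⟨s, hs, hs'⟩ | ⟨h1, h2⟩
      · rw [hs']
        refine (hc'4 s hs).imp id fun hbs => ⟨hbs, ?_⟩
        have := hc'2 s hs
        omega
      · exact Or.inr ⟨by omega, h2⟩
    · intro s hs
      rw [← hc'3 s hs, g4 _ (hτ.lt s hs)]
    · rw [← Finset.sum_Ico_consecutive _ (show b ≤ b + (h - M) by omega)
        (show b + (h - M) ≤ b + (r - 2 * M) by omega)]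
      have : ∑ j ∈ Finset.Ico b (b + (h - M)), |p y (j + 1) - p y j| ≤ 2 := by
        refine sum_abs_sub_le_of_monotoneOn (fun j hj k hk hjk => ?_) g3
        obtain ⟨s, hs, hsj⟩ := hc'5 j hj.1 hj.2
        obtain ⟨u, hu, huk⟩ := hc'5 k hk.1 hk.2
        rcases hjk.eq_or_lt with rfl | hlt
        · exact le_rfl
        · have hsu := hc'6 s hs u hu (by rw [hsj]; exact hj.1) (by omega)
          rw [← hsj, ← huk, g4 s hs, g4 u hu]
          gcongr
      linarith
  choose F P hF hFP using key
  obtain ⟨l, hl1, hl2, -⟩ := exists_label hc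
  refine ⟨fun y k => if k < h then c (parkSlot (2 * M) y k) else
      F (parkOcc (2 * M) y h) (fun i => y (i + h) / 2) (k - h),
    fun y j => if j < b then l j else P (parkOcc (2 * M) y h) (fun i => y (i + h) / 2) j, ?_, ?_⟩
  · intro y z k hyz
    dsimp only
    split_ifs with hk
    · rw [parkSlot_congr hyz]
    · rw [parkOcc_congr fun i hi => hyz i (by omega)]
      exact hF _ _ _ _ fun i hi => by rw [hyz (i + h) (by omega)]
  intro y hy
  have hpk := isParking_parkSlot y hh.le
  set O := parkOcc (2 * M) y h with hO
  set z : ℕ → ℕ := fun i => y (i + h) / 2 with hz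
  have hzM : ∀ i, z i < M := fun i => by
    have := hy (i + h)
    simp only [hz]
    omega
  obtain ⟨g1, g2, g3, ⟨τ, hτ, hτp⟩, g5, g6⟩ :=
    hFP O (parkOcc_subset y hh.le) (card_parkOcc y hh.le) z hzM
  have hmemO : ∀ k < h, parkSlot (2 * M) y k ∈ O := fun k hk => by
    rw [hO, parkOcc_eq_image]
    exact Finset.mem_image_of_mem _ (Finset.mem_range.2 hk)
  have hne : ∀ k < h, ∀ i < r', c (parkSlot (2 * M) y k) ≠ F O z i := by
    intro k hk i hi heq
    have h1 := hpk.lt k (Finset.mem_range.2 hk)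
    rcases g2 i hi with ⟨s, hs, hs'⟩ | ⟨h2, -⟩
    · rw [Finset.mem_sdiff] at hs
      have := hc (by simpa using h1) (by simpa using hs.1) (heq.trans hs')
      exact hs.2 (this ▸ hmemO k hk)
    · have := hb _ h1
      omega
  refine ⟨?_, ?_, ?_, ?_, ?_, ?_⟩
  · intro k₁ h₁ k₂ h₂ heq
    dsimp only at heq
    rw [Finset.mem_coe, Finset.mem_range] at h₁ h₂
    split_ifs at heq with h3 h4 h4
    · exact hpk.inj (by simpa using h3) (by simpa using h4)
        (hc (by simpa using hpk.lt k₁ (by simpa using h3))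
          (by simpa using hpk.lt k₂ (by simpa using h4)) heq)
    · exact absurd heq (hne k₁ h3 _ (by omega))
    · exact absurd heq.symm (hne k₂ h4 _ (by omega))
    · have := g1 (by simp; omega) (by simp; omega) heq
      omega
  · intro k hk
    dsimp only
    split_ifs with hkh
    · exact Or.inl ⟨_, hpk.lt k (by simpa using hkh), rfl⟩
    · rcases g2 (k - h) (by omega) with ⟨s, hs, hs'⟩ | hs
      · exact Or.inl ⟨s, by simpa using (Finset.mem_sdiff.1 hs).1, hs'⟩
      · exact Or.inr hs
  · intro j
    dsimp only
    split_ifs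
    exacts [hl1 j, g3 j]
  · intro s hs
    dsimp only
    rw [if_pos (hb s hs), hl2 s hs]
  · refine le_trans (Finset.sum_le_sum fun j hj => ?_) g5
    rw [Finset.mem_Ico] at hj
    dsimp only
    rw [if_neg (show ¬ j + 1 < b by omega), if_neg (show ¬ j < b by omega)]
  · rw [hr, Finset.sum_range_add]
    have hfirst := sum_parkSlot_le hy hh
    have e1 : ∑ k ∈ Finset.range h, |(y k : ℝ) / (2 * M : ℕ) -
        (if (if k < h then c (parkSlot (2 * M) y k) else F O z (k - h)) < b then
          l (if k < h then c (parkSlot (2 * M) y k) else F O z (k - h)) else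
          P O z (if k < h then c (parkSlot (2 * M) y k) else F O z (k - h)))| ≤
        displacement (2 * M) (surplus h y) := by
      refine le_trans (Finset.sum_le_sum fun k hk => ?_) hfirst
      have hk' := Finset.mem_range.1 hk
      rw [if_pos hk', if_pos (hb _ (hpk.lt k hk)), hl2 _ (hpk.lt k hk), abs_sub_comm]
    have e2 := sum_free_le hy hh hM hτ
    set D : ℕ → ℝ := fun j => |P O z j - (if j < b then l j else P O z j)| with hD
    have e3 : ∑ i ∈ Finset.range r', D (F O z i) ≤ displacement M (freeSurplus M h y) + 1 := by
      refine le_trans ?_ e2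
      rw [← Finset.sum_image (g := F O z) (f := D) g1]
      have e4 : ∑ s ∈ Finset.range (2 * M) \ O, |(τ s : ℝ) / M - s / (2 * M : ℕ)| =
          ∑ j ∈ (Finset.range (2 * M) \ O).image c, D j := by
        rw [Finset.sum_image (hc.mono (by exact_mod_cast Finset.sdiff_subset))]
        refine Finset.sum_congr rfl fun s hs => ?_
        have hs' : s < 2 * M := Finset.mem_range.1 (Finset.mem_sdiff.1 hs).1
        simp only [hD]
        rw [if_pos (hb s hs'), hl2 s hs', hτp s hs]
      rw [e4]
      rw [← Finset.sum_filter_ne_zero]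
      refine Finset.sum_le_sum_of_subset_of_nonneg (fun j hj => ?_) fun _ _ _ => abs_nonneg _
      obtain ⟨hj, hDj⟩ := Finset.mem_filter.1 hj
      obtain ⟨i, hi, rfl⟩ := Finset.mem_image.1 hj
      rcases g2 i (Finset.mem_range.1 hi) with ⟨s, hs, hs'⟩ | ⟨h1, -⟩
      · rw [hs']
        exact Finset.mem_image_of_mem _ hs
      · exact absurd (by simp only [hD]; rw [if_neg (by omega)]; simp) hDj
    have e5 : ∀ i ∈ Finset.range r', |(y (h + i) : ℝ) / (2 * M : ℕ) -
        (if (if h + i < h then c (parkSlot (2 * M) y (h + i)) else F O z (h + i - h)) < b then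
          l (if h + i < h then c (parkSlot (2 * M) y (h + i)) else F O z (h + i - h)) else
          P O z (if h + i < h then c (parkSlot (2 * M) y (h + i)) else F O z (h + i - h)))| ≤
        1 / (2 * M) + |(z i : ℝ) / M - P O z (F O z i)| + D (F O z i) := by
      intro i _
      rw [if_neg (show ¬ h + i < h by omega), Nat.add_sub_cancel_left]
      have : |(y (h + i) : ℝ) / (2 * M : ℕ) - (z i : ℝ) / M| ≤ 1 / (2 * M) := by
        have hM0 : (0 : ℝ) < M := by exact_mod_cast (by omega : 0 < M)
        have e : (y (h + i) : ℝ) = 2 * (z i : ℕ) + (y (h + i) % 2 : ℕ) := by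
          simp only [hz]
          rw [add_comm i h]
          exact_mod_cast (Nat.div_add_mod (y (h + i)) 2).symm
        have e' : (y (h + i) : ℝ) / (2 * M : ℕ) - (z i : ℝ) / M =
            (y (h + i) % 2 : ℕ) / (2 * M) := by
          rw [e]
          push_cast
          field_simp
          ring
        rw [e', abs_of_nonneg (by positivity)]
        have : ((y (h + i) % 2 : ℕ) : ℝ) ≤ 1 := by exact_mod_cast (by omega : y (h + i) % 2 ≤ 1)
        gcongr
      refine (abs_sub_le _ ((z i : ℝ) / M) _).trans ?_
      rw [add_assoc]
      refine add_le_add this ((abs_sub_le _ (P O z (F O z i)) _).trans le_rfl)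
    have e6 := Finset.sum_le_sum e5
    rw [Finset.sum_add_distrib, Finset.sum_add_distrib, Finset.sum_const, Finset.card_range,
      nsmul_eq_mul] at e6
    have e7 : (r' : ℝ) * (1 / (2 * M)) ≤ 1 := by
      rw [mul_one_div]
      exact div_le_one_of_le₀ (by exact_mod_cast hr2) (by positivity)
    have e8 := add_le_add e1 e6
    refine e8.trans ?_
    unfold phaseCost
    linarith

/-- The number of items that remain when `M` slots are in use. -/
def remaining (M : ℕ) : ℕ := (3 * M + 1) / 2

/-- The cost of placing `r` items when `m * 2 ^ J` slots are in use. -/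
noncomputable def totalCost (m : ℕ) : ℕ → ℕ → (ℕ → ℕ) → ℝ
  | 0, r, _ => r
  | J + 1, r, y =>
    phaseCost (m * 2 ^ J) (r - remaining (m * 2 ^ J)) y +
      totalCost m J (remaining (m * 2 ^ J)) fun i => y (i + (r - remaining (m * 2 ^ J))) / 2

lemma placeable_totalCost {m : ℕ} (hm : 8 ≤ m) (J r : ℕ) (h1 : 7 * (m * 2 ^ J) ≤ 5 * r)
    (h2 : 5 * r ≤ 8 * (m * 2 ^ J)) : Placeable (m * 2 ^ J) r (totalCost m J r) (2 * J) := by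
  induction J generalizing r with
  | zero =>
    have := placeable_base (M := m * 2 ^ 0) (r := r) (by omega)
    simpa [totalCost] using this
  | succ J ih =>
    have hpow : m * 2 ^ (J + 1) = 2 * (m * 2 ^ J) := by ring
    have hmJ : 8 ≤ m * 2 ^ J := hm.trans (Nat.le_mul_of_pos_right _ (by positivity))
    rw [hpow] at h1 h2 ⊢
    generalize hMdef : m * 2 ^ J = M at *
    have hrem : remaining M = (3 * M + 1) / 2 := rfl
    have := placeable_step (ih (remaining M) (by omega) (by omega)) (r := r)
      (h := r - remaining M) (by omega) (by omega) (by omega) (by omega) (by omega)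
    simp only [totalCost, hMdef]
    convert this using 1
    push_cast
    ring

/-- `E` behaves like the expectation over sequences whose first `r` entries are independent and
uniform in `{0, …, M - 1}`. -/
def IsUniformExpectation (M r : ℕ) (E : ((ℕ → ℕ) → ℝ) →ₗ[ℝ] ℝ) : Prop :=
  ∀ g : ℕ → ℕ → ℝ, E (fun y => ∏ k ∈ Finset.range r, g k (y k)) =
    ∏ k ∈ Finset.range r, (∑ s ∈ Finset.range M, g k s) / M

lemma sum_range_two_mul_div_two (g : ℕ → ℝ) (M : ℕ) :
    ∑ s ∈ Finset.range (2 * M), g (s / 2) = 2 * ∑ s ∈ Finset.range M, g s := by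
  induction M with
  | zero => simp
  | succ M ih =>
    rw [show 2 * (M + 1) = 2 * M + 1 + 1 by ring, Finset.sum_range_succ, Finset.sum_range_succ, ih,
      Finset.sum_range_succ, show (2 * M + 1) / 2 = M by omega, show 2 * M / 2 = M by omega]
    ring

lemma prod_ite_eq_exp_load (h : ℕ) (y : ℕ → ℕ) (q p : ℕ) (t : ℝ) :
    ∏ k ∈ Finset.range h, (if q ≤ y k ∧ y k ≤ p then Real.exp t else 1) =
      Real.exp (IsParking.load (Finset.range h) y q p * t) := by
  rw [Finset.prod_ite, Finset.prod_const, Finset.prod_const_one, mul_one, Real.exp_nat_mul]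
  rfl

lemma sum_ite_Icc {M q p : ℕ} (hp : p < M) (hq : q ≤ p + 1) (a : ℝ) :
    ∑ s ∈ Finset.range M, (if q ≤ s ∧ s ≤ p then a else 1) = M + (p + 1 - q) * (a - 1) := by
  have h1 : ∀ s, (if q ≤ s ∧ s ≤ p then a else (1 : ℝ)) =
      1 + if q ≤ s ∧ s ≤ p then a - 1 else 0 := by
    intro s
    split_ifs <;> ring
  have h2 : (Finset.range M).filter (fun s => q ≤ s ∧ s ≤ p) = Finset.Ico q (p + 1) := by
    ext s
    simp only [Finset.mem_filter, Finset.mem_range, Finset.mem_Ico]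
    omega
  rw [Finset.sum_congr rfl fun s _ => h1 s, Finset.sum_add_distrib, ← Finset.sum_filter, h2]
  rw [Finset.sum_const, Finset.sum_const, Nat.card_Ico, Finset.card_range, nsmul_eq_mul, nsmul_eq_mul, mul_one,
    Nat.cast_sub hq]
  push_cast
  rfl

/-- A bound for the expectation of `surplus` and `deficit`. -/
noncomputable def geomBound : ℝ := 10 * (1 - Real.exp (-(9 / 2000)))⁻¹

lemma geomBound_nonneg : 0 ≤ geomBound := by
  have : Real.exp (-(9 / 2000)) ≤ 1 := Real.exp_le_one_iff.2 (by norm_num)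
  unfold geomBound
  have : 0 ≤ 1 - Real.exp (-(9 / 2000)) := by linarith
  positivity

lemma sum_exp_le_geomBound (p : ℕ) :
    ∑ q ∈ Finset.range (p + 1), 10 * Real.exp (-(9 / 2000) * (p + 1 - q)) ≤ geomBound := by
  set ρ := Real.exp (-(9 / 2000)) with hρ
  have h0 : 0 ≤ ρ := (Real.exp_pos _).le
  have h1 : ρ < 1 := Real.exp_lt_one_iff.2 (by norm_num)
  have h2 : ∀ q ∈ Finset.range (p + 1),
      Real.exp (-(9 / 2000) * (p + 1 - q)) ≤ ρ ^ (p + 1 - 1 - q) := by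
    intro q hq
    have hq' : q ≤ p := by simpa [Nat.lt_succ_iff] using hq
    rw [hρ, ← Real.exp_nat_mul, Real.exp_le_exp, Nat.add_sub_cancel, Nat.cast_sub hq']
    linarith
  rw [← Finset.mul_sum, geomBound]
  refine mul_le_mul_of_nonneg_left ((Finset.sum_le_sum h2).trans ?_) (by norm_num)
  rw [Finset.sum_range_reflect (fun j => ρ ^ j), ← tsum_geometric_of_lt_one h0 h1]
  exact (summable_geometric_of_lt_one h0 h1).sum_le_tsum _ fun _ _ => by positivity

lemma exp_tenth_sub_one_le : Real.exp (1 / 10) - 1 ≤ 11 / 100 := by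
  have := Real.abs_exp_sub_one_sub_id_le (x := 1 / 10) (by norm_num [abs_of_pos])
  rw [abs_le] at this
  norm_num at this ⊢
  linarith [this.2]

lemma exp_neg_tenth_sub_one_le : Real.exp (-(1 / 10)) - 1 ≤ -(95 / 1000) := by
  have h : Real.exp (1 / 10) ≥ 1 / 10 + 1 + (1 / 10) ^ 2 / 2 := by
    have := Real.quadratic_le_exp_of_nonneg (x := 1 / 10) (by norm_num)
    linarith
  rw [Real.exp_neg, sub_le_iff_le_add]
  refine inv_le_of_inv_le₀ (by norm_num) (le_trans (by norm_num) h)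

namespace IsUniformExpectation

variable {M r h : ℕ} {E : ((ℕ → ℕ) → ℝ) →ₗ[ℝ] ℝ}

lemma apply_prod (hE : IsUniformExpectation M r E) (hM : 0 < M) (hr : h ≤ r) (g : ℕ → ℝ) :
    E (fun y => ∏ k ∈ Finset.range h, g (y k)) = ((∑ s ∈ Finset.range M, g s) / M) ^ h := by
  obtain ⟨d, rfl⟩ := Nat.exists_eq_add_of_le hr
  have hM' : (M : ℝ) ≠ 0 := by positivity
  have := hE fun k s => if k < h then g s else 1
  simp only [Finset.prod_range_add] at this
  rw [Finset.prod_congr rfl fun k hk => by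
    rw [Finset.sum_congr rfl fun s _ => if_pos (Finset.mem_range.1 hk)]] at this
  simp only [show ∀ x, ¬ h + x < h by omega, if_false] at this
  simp only [Finset.prod_const, Finset.sum_const, Finset.card_range, nsmul_eq_mul, mul_one, one_pow,
    div_self hM'] at this
  rw [← this]
  congr 1
  ext y
  exact Finset.prod_congr rfl fun k hk => (if_pos (Finset.mem_range.1 hk)).symm

lemma apply_const (hE : IsUniformExpectation M r E) (hM : 0 < M) (a : ℝ) : E (fun _ => a) = a := by
  have := hE.apply_prod hM (Nat.zero_le r) (fun _ => 1)
  simp only [Finset.range_zero, Finset.prod_empty, pow_zero] at this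
  have h2 : (fun _ : ℕ → ℕ => a) = a • fun _ => (1 : ℝ) := by
    ext
    simp
  rw [h2, map_smul, this, smul_eq_mul, mul_one]

lemma comp_shift {r' : ℕ} (hE : IsUniformExpectation (2 * M) (h + r') E) (hM : 0 < M) :
    IsUniformExpectation M r' (E ∘ₗ LinearMap.funLeft ℝ ℝ fun y i => y (i + h) / 2) := by
  intro g
  have hM' : (M : ℝ) ≠ 0 := by positivity
  have := hE fun k s => if k < h then 1 else g (k - h) (s / 2)
  simp only [Finset.prod_range_add] at this
  simp only [show ∀ x, ¬ h + x < h by omega, if_false, Nat.add_sub_cancel_left,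
    sum_range_two_mul_div_two] at this
  rw [Finset.prod_congr (M := ℝ) (s₁ := Finset.range h) rfl fun k hk => by
    rw [Finset.sum_congr rfl fun s _ => if_pos (Finset.mem_range.1 hk)]] at this
  have h2 : ∀ k, 2 * (∑ s ∈ Finset.range M, g k s) / (2 * M : ℕ) =
      (∑ s ∈ Finset.range M, g k s) / M := by
    intro k
    push_cast
    exact mul_div_mul_left _ _ two_ne_zero
  simp only [h2, Finset.sum_const, Finset.card_range, nsmul_eq_mul, mul_one,
    div_self (show ((2 * M : ℕ) : ℝ) ≠ 0 by positivity), Finset.prod_const_one, one_mul] at this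
  rw [← this, LinearMap.comp_apply]
  congr 1
  ext y
  rw [Finset.prod_congr (M := ℝ) (s₁ := Finset.range h) rfl fun k hk =>
    if_pos (Finset.mem_range.1 hk)]
  simp [LinearMap.funLeft_apply, add_comm]

lemma apply_exp_load_le (hE : IsUniformExpectation M r E) (hr : h ≤ r) {q p : ℕ}
    (hp : p < M) (hq : q ≤ p + 1) (t : ℝ) :
    E (fun y => Real.exp (IsParking.load (Finset.range h) y q p * t)) ≤
      Real.exp (h / M * (p + 1 - q) * (Real.exp t - 1)) := by
  have hM : (0 : ℝ) < M := by exact_mod_cast (by omega : 0 < M)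
  have hlen : (p + 1 - q : ℝ) ≤ M := by
    have : (p + 1 : ℝ) ≤ M := by exact_mod_cast hp
    have : (0 : ℝ) ≤ q := by positivity
    linarith
  have hlen0 : (0 : ℝ) ≤ p + 1 - q := by
    have : (q : ℝ) ≤ p + 1 := by exact_mod_cast hq
    linarith
  simp_rw [← prod_ite_eq_exp_load]
  rw [hE.apply_prod (by omega) hr fun s => if q ≤ s ∧ s ≤ p then Real.exp t else 1,
    sum_ite_Icc hp hq]
  have e : ((h : ℝ) / M * (p + 1 - q) * (Real.exp t - 1)) =
      h * ((p + 1 - q) * (Real.exp t - 1) / M) := by ring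
  rw [e, Real.exp_nat_mul, add_div, div_self hM.ne']
  refine pow_le_pow_left₀ ?_ ?_ h
  · have : -1 ≤ (p + 1 - q) * (Real.exp t - 1) / M := by
      rw [le_div_iff₀ hM]
      have := Real.exp_pos t
      nlinarith [mul_nonneg hlen0 this.le]
    linarith
  · linarith [Real.add_one_le_exp ((p + 1 - q) * (Real.exp t - 1) / M)]

lemma apply_surplus_le (hE : IsUniformExpectation M r E) (hr : h ≤ r) {p : ℕ} (hp : p < M)
    (hh : 20 * h ≤ 17 * M) : E (fun y => surplus h y p) ≤ geomBound := by
  have hM : (0 : ℝ) < M := by exact_mod_cast (by omega : 0 < M)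
  have e : (fun y => surplus h y p) = ∑ q ∈ Finset.range (p + 1),
      (10 * Real.exp (-(p + 1 - q) / 10)) • fun y => Real.exp
        (IsParking.load (Finset.range h) y q p * (1 / 10)) := by
    ext y
    rw [Finset.sum_apply, surplus]
    refine Finset.sum_congr rfl fun q _ => ?_
    rw [Pi.smul_apply, smul_eq_mul, mul_assoc, ← Real.exp_add]
    ring_nf
  rw [e, map_sum]
  refine le_trans (Finset.sum_le_sum fun q hq => ?_) (sum_exp_le_geomBound p)
  have hq' : q ≤ p + 1 := (Finset.mem_range.1 hq).le
  have hlen0 : (0 : ℝ) ≤ p + 1 - q := by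
    have : (q : ℝ) ≤ p + 1 := by exact_mod_cast hq'
    linarith
  have hM' : (h : ℝ) / M ≤ 17 / 20 := by
    rw [div_le_div_iff₀ hM (by norm_num)]
    have : (20 * h : ℝ) ≤ 17 * M := by exact_mod_cast hh
    linarith
  rw [map_smul, smul_eq_mul, mul_assoc]
  refine mul_le_mul_of_nonneg_left ?_ (by norm_num)
  refine (mul_le_mul_of_nonneg_left (hE.apply_exp_load_le hr hp hq' _)
    (Real.exp_pos _).le).trans ?_
  rw [← Real.exp_add, Real.exp_le_exp]
  have h1 := exp_tenth_sub_one_le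
  have h2 : (h : ℝ) / M * (p + 1 - q) * (Real.exp (1 / 10) - 1) ≤
      17 / 20 * (p + 1 - q) * (11 / 100) := by
    gcongr
    linarith [Real.add_one_le_exp (1 / 10 : ℝ)]
  linarith

lemma apply_deficit_le (hE : IsUniformExpectation (2 * M) r E) (hr : h ≤ r) {p : ℕ} (hp : p < M)
    (hh : 11 * (2 * M) ≤ 20 * h) : E (fun y => deficit h y p) ≤ geomBound := by
  have hM : (0 : ℝ) < M := by exact_mod_cast (by omega : 0 < M)
  have e : (fun y => deficit h y p) = ∑ q ∈ Finset.range (p + 1),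
      (10 * Real.exp ((p + 1 - q) / 10)) • fun y => Real.exp
        (IsParking.load (Finset.range h) y (2 * q) (2 * p + 1) * (-(1 / 10))) := by
    ext y
    rw [Finset.sum_apply, deficit]
    refine Finset.sum_congr rfl fun q _ => ?_
    rw [Pi.smul_apply, smul_eq_mul, mul_assoc, ← Real.exp_add]
    ring_nf
  rw [e, map_sum]
  refine le_trans (Finset.sum_le_sum fun q hq => ?_) (sum_exp_le_geomBound p)
  have hq' : q ≤ p + 1 := (Finset.mem_range.1 hq).le
  have hlen0 : (0 : ℝ) ≤ p + 1 - q := by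
    have : (q : ℝ) ≤ p + 1 := by exact_mod_cast hq'
    linarith
  have hM' : 11 / 20 ≤ (h : ℝ) / (2 * M : ℕ) := by
    push_cast
    rw [div_le_div_iff₀ (by norm_num) (by positivity)]
    have : (11 * (2 * M) : ℝ) ≤ 20 * h := by exact_mod_cast hh
    linarith
  rw [map_smul, smul_eq_mul, mul_assoc]
  refine mul_le_mul_of_nonneg_left ?_ (by norm_num)
  refine (mul_le_mul_of_nonneg_left (hE.apply_exp_load_le hr (by omega) (by omega) _)
    (Real.exp_pos _).le).trans ?_
  rw [← Real.exp_add, Real.exp_le_exp]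
  have h1 := exp_neg_tenth_sub_one_le
  have h2 : 11 / 20 * (2 * (p + 1 - q)) * (95 / 1000) ≤
      (h : ℝ) / (2 * M : ℕ) * (2 * (p + 1 - q)) * (1 - Real.exp (-(1 / 10))) := by
    gcongr
    linarith
  push_cast at h2 ⊢
  linarith

lemma apply_displacement_le {N : ℕ} (w : (ℕ → ℕ) → ℕ → ℝ) {K : ℝ} (hN : 0 < N)
    (hw : ∀ p < N, E (fun y => w y p) ≤ K) : E (fun y => displacement N (w y)) ≤ 3 * K := by
  have hN' : (0 : ℝ) < N := by exact_mod_cast hN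
  have e : (fun y => displacement N (w y)) =
      (1 / N : ℝ) • (∑ p ∈ Finset.range N, fun y => w y p) + (2 : ℝ) • fun y => w y (N - 1) := by
    ext y
    simp only [displacement, Pi.add_apply, Pi.smul_apply, Finset.sum_apply, smul_eq_mul]
    ring
  rw [e, map_add, map_smul, map_smul, map_sum, smul_eq_mul, smul_eq_mul]
  have h1 : ∑ p ∈ Finset.range N, E (fun y => w y p) ≤ N * K := by
    refine (Finset.sum_le_sum fun p hp => hw p (Finset.mem_range.1 hp)).trans ?_
    simp
  have h2 : 1 / (N : ℝ) * ∑ p ∈ Finset.range N, E (fun y => w y p) ≤ K := by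
    rw [one_div_mul_eq_div, div_le_iff₀ hN']
    linarith
  have h3 := hw (N - 1) (by omega)
  linarith

lemma apply_phaseCost_le (hE : IsUniformExpectation (2 * M) r E) (hr : h ≤ r) (hM : 0 < M)
    (h1 : 20 * h ≤ 17 * (2 * M)) (h2 : 11 * (2 * M) ≤ 20 * h) :
    E (fun y => phaseCost M h y) ≤ 15 * geomBound + 2 := by
  have e : (fun y => phaseCost M h y) = (fun y => displacement (2 * M) (surplus h y)) +
      (fun y => displacement M (freeSurplus M h y)) + fun _ => 2 := rfl
  rw [e, map_add, map_add, hE.apply_const (by omega)]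
  have h3 := apply_displacement_le (E := E) (surplus h) (N := 2 * M) (by omega)
    fun p hp => hE.apply_surplus_le hr hp h1
  have h4 : E (fun y => displacement M (freeSurplus M h y)) ≤ 3 * (4 * geomBound) := by
    refine apply_displacement_le (freeSurplus M h) hM fun p hp => ?_
    have e : (fun y => freeSurplus M h y p) = (fun y => surplus h y (2 * p + 1)) +
        (2 : ℝ) • (fun y => surplus h y (2 * M - 1)) + fun y => deficit h y p := rfl
    rw [e, map_add, map_add, map_smul, smul_eq_mul]
    have := hE.apply_surplus_le hr (p := 2 * p + 1) (by omega) h1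
    have := hE.apply_surplus_le hr (p := 2 * M - 1) (by omega) h1
    have := hE.apply_deficit_le hr hp h2
    linarith
  linarith

end IsUniformExpectation

lemma IsUniformExpectation.apply_totalCost_le {m : ℕ} (hm : 8 ≤ m) (J r : ℕ)
    {E : ((ℕ → ℕ) → ℝ) →ₗ[ℝ] ℝ} (hE : IsUniformExpectation (m * 2 ^ J) r E)
    (h1 : 7 * (m * 2 ^ J) ≤ 5 * r) (h2 : 5 * r ≤ 8 * (m * 2 ^ J)) :
    E (totalCost m J r) ≤ (15 * geomBound + 2) * J + 2 * m := by
  induction J generalizing r E with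
  | zero =>
    have e : totalCost m 0 r = fun _ => (r : ℝ) := by
      ext
      simp [totalCost]
    rw [e, hE.apply_const (by omega)]
    have : (r : ℝ) ≤ 2 * m := by exact_mod_cast (by omega : r ≤ 2 * m)
    simpa using this
  | succ J ih =>
    have hpow : m * 2 ^ (J + 1) = 2 * (m * 2 ^ J) := by ring
    have hmJ : 8 ≤ m * 2 ^ J := hm.trans (Nat.le_mul_of_pos_right _ (by positivity))
    rw [hpow] at h1 h2 hE
    have e : totalCost m (J + 1) r =
        (fun y => phaseCost (m * 2 ^ J) (r - remaining (m * 2 ^ J)) y) + LinearMap.funLeft ℝ ℝ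
          (fun (y : ℕ → ℕ) i => y (i + (r - remaining (m * 2 ^ J))) / 2)
          (totalCost m J (remaining (m * 2 ^ J))) := by
      ext y
      simp [totalCost, LinearMap.funLeft_apply]
    rw [e, map_add]
    generalize hMdef : m * 2 ^ J = M at *
    have hrem : remaining M = (3 * M + 1) / 2 := rfl
    have hr : r = (r - remaining M) + remaining M := by omega
    have h3 := hE.apply_phaseCost_le (h := r - remaining M) (by omega) (by omega) (by omega)
      (by omega)
    rw [hr] at hE
    have h4 := ih (remaining M) (hE.comp_shift (by omega)) (by omega) (by omega)
    rw [LinearMap.comp_apply] at h4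
    push_cast
    linarith

/-- The sequence of the entries of a tuple, continued by zeros. -/
def extendTuple {n M : ℕ} (y : Fin n → Fin M) (i : ℕ) : ℕ := if h : i < n then y ⟨i, h⟩ else 0

lemma extendTuple_lt {n M : ℕ} (hM : 0 < M) (y : Fin n → Fin M) (i : ℕ) :
    extendTuple y i < M := by
  unfold extendTuple
  split_ifs
  exacts [Fin.isLt _, hM]

lemma extendTuple_val {n M : ℕ} (y : Fin n → Fin M) (k : Fin n) : extendTuple y k = y k := by
  simp [extendTuple]

/-- The expectation of a function of `n` independent uniform entries in `{0, …, M - 1}`. -/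
noncomputable def uniformExpectation (M n : ℕ) : ((ℕ → ℕ) → ℝ) →ₗ[ℝ] ℝ where
  toFun F := (∑ y : Fin n → Fin M, F (extendTuple y)) / M ^ n
  map_add' F G := by simp [Finset.sum_add_distrib, add_div]
  map_smul' a F := by simp [← Finset.mul_sum, mul_div_assoc]

lemma isUniformExpectation_uniformExpectation (M n : ℕ) :
    IsUniformExpectation M n (uniformExpectation M n) := by
  intro g
  change (∑ y : Fin n → Fin M, ∏ k ∈ Finset.range n, g k (extendTuple y k)) / (M : ℝ) ^ n = _
  rw [Finset.prod_div_distrib, Finset.prod_const, Finset.card_range]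
  congr 1
  simp_rw [Finset.prod_range, Finset.sum_range, extendTuple_val]
  rw [Finset.prod_univ_sum, Fintype.piFinset_univ]

/-- The index of the interval of length `1 / M` that contains `u`. -/
noncomputable def letter {M : ℕ} (hM : 0 < M) (u : ℝ) : Fin M :=
  ⟨min ⌊u * M⌋₊ (M - 1), by omega⟩

lemma measurable_letter {M : ℕ} (hM : 0 < M) : Measurable (letter hM) := by
  have h : Measurable fun u : ℝ => ⌊u * M⌋₊ := Nat.measurable_floor.comp (measurable_id.mul_const _)
  have h2 : Measurable fun k : ℕ => (⟨min k (M - 1), by omega⟩ : Fin M) := measurable_from_top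
  exact h2.comp h

lemma letter_spec {M : ℕ} (hM : 0 < M) {u : ℝ} (hu : u ∈ Set.Icc (0 : ℝ) 1) :
    u ∈ Set.Icc ((letter hM u : ℕ) / M : ℝ) (((letter hM u : ℕ) + 1) / M) := by
  have hM' : (0 : ℝ) < M := by exact_mod_cast hM
  have h0 : 0 ≤ u * M := mul_nonneg hu.1 hM'.le
  rw [Set.mem_Icc, div_le_iff₀ hM', le_div_iff₀ hM']
  constructor
  · refine le_trans ?_ (Nat.floor_le h0)
    exact_mod_cast min_le_left _ _
  · simp only [letter]
    rcases min_cases ⌊u * M⌋₊ (M - 1) with ⟨h, -⟩ | ⟨h, -⟩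
    · rw [h]
      exact (Nat.lt_floor_add_one _).le
    · rw [h]
      have : ((M - 1 : ℕ) : ℝ) + 1 = M := by exact_mod_cast (by omega : M - 1 + 1 = M)
      rw [this]
      nlinarith [hu.2]

lemma letter_eq {M : ℕ} (hM : 0 < M) (s : Fin M) {u : ℝ}
    (hu : u ∈ Set.Ioo ((s : ℕ) / M : ℝ) (((s : ℕ) + 1) / M)) : letter hM u = s := by
  have hM' : (0 : ℝ) < M := by exact_mod_cast hM
  rw [Set.mem_Ioo, div_lt_iff₀ hM', lt_div_iff₀ hM'] at hu
  ext
  have h0 : (0 : ℝ) ≤ (s : ℕ) := by positivity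
  have : ⌊u * M⌋₊ = s := (Nat.floor_eq_iff (by linarith)).2 ⟨hu.1.le, hu.2⟩
  simp only [letter, this]
  omega

lemma volume_letter {M : ℕ} (hM : 0 < M) (s : Fin M) :
    (volume : Measure ℝ).restrict (Set.Icc 0 1) (letter hM ⁻¹' {s}) = ENNReal.ofReal (1 / M) := by
  have hM' : (0 : ℝ) < M := by exact_mod_cast hM
  have hlen : ((s : ℕ) + 1) / M - (s : ℕ) / M = (1 / M : ℝ) := by ring
  rw [Measure.restrict_apply (measurable_letter hM (measurableSet_singleton s))]
  apply le_antisymm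
  · rw [← hlen, ← Real.volume_Icc]
    refine measure_mono fun u hu => ?_
    have := letter_spec hM hu.2
    rwa [hu.1] at this
  · rw [← hlen, ← Real.volume_Ioo]
    refine measure_mono fun u hu => ⟨letter_eq hM s hu, ?_, ?_⟩
    · exact le_trans (by positivity) hu.1.le
    · refine hu.2.le.trans (div_le_one_of_le₀ ?_ hM'.le)
      exact_mod_cast s.isLt

instance isProbabilityMeasure_uniformCube (n : ℕ) : IsProbabilityMeasure (uniformCube n) := by
  have : IsProbabilityMeasure ((volume : Measure ℝ).restrict (Set.Icc 0 1)) := ⟨by simp⟩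
  unfold uniformCube
  infer_instance

lemma ae_uniformCube_mem (n : ℕ) : ∀ᵐ x ∂uniformCube n, ∀ k, x k ∈ Set.Icc (0 : ℝ) 1 := by
  rw [ae_all_iff]
  intro k
  exact Measure.tendsto_eval_ae_ae.eventually (ae_restrict_mem measurableSet_Icc)

/-- The intervals of length `1 / M` that contain the entries of `x`. -/
noncomputable def letters {n M : ℕ} (hM : 0 < M) (x : Fin n → ℝ) : Fin n → Fin M :=
  fun k => letter hM (x k)

lemma measurable_letters {n M : ℕ} (hM : 0 < M) :
    Measurable (letters hM : (Fin n → ℝ) → Fin n → Fin M) :=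
  measurable_pi_lambda _ fun k => (measurable_letter hM).comp (measurable_pi_apply k)

lemma integrable_comp_letters {n M : ℕ} (hM : 0 < M) (F : (Fin n → Fin M) → ℝ) :
    Integrable (fun x => F (letters hM x)) (uniformCube n) :=
  Integrable.comp_measurable (Integrable.of_finite) (measurable_letters hM)

lemma integral_comp_letters {n M : ℕ} (hM : 0 < M) (F : (ℕ → ℕ) → ℝ) :
    ∫ x, F (extendTuple (letters hM x)) ∂uniformCube n = uniformExpectation M n F := by
  have := Measure.isProbabilityMeasure_map (μ := uniformCube n)
    (measurable_letters (n := n) hM).aemeasurable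
  rw [← integral_map (φ := letters hM) (f := fun y : Fin n → Fin M => F (extendTuple y))
    (measurable_letters hM).aemeasurable (Measurable.of_discrete).aestronglyMeasurable,
    integral_fintype Integrable.of_finite]
  change _ = (∑ y : Fin n → Fin M, F (extendTuple y)) / (M : ℝ) ^ n
  rw [Finset.sum_div]
  refine Finset.sum_congr rfl fun y _ => ?_
  have h1 : letters hM ⁻¹' {y} = Set.univ.pi fun k => letter hM ⁻¹' {y k} := by
    ext x
    simp [letters, funext_iff]
  rw [map_measureReal_apply (measurable_letters hM) (measurableSet_singleton y), h1,
    measureReal_def, uniformCube, Measure.pi_pi]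
  simp_rw [volume_letter hM]
  rw [Finset.prod_const, Finset.card_univ, Fintype.card_fin, ENNReal.toReal_pow,
    ENNReal.toReal_ofReal (by positivity), smul_eq_mul, one_div, inv_pow, ← div_eq_inv_mul]

lemma strategyCost_le {n : ℕ} (S : OnlineStrategy n) (x : Fin n → ℝ) (p : ℕ → ℝ) :
    strategyCost S x ≤ ∑ j ∈ Finset.range n, |p (j + 1) - p j| +
      2 * ∑ k, |x k - p (S.place x k)| := by
  have h1 : ∑ j ∈ Finset.range n, |strategyArr S x j - p j| = ∑ k, |x k - p (S.place x k)| := by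
    have hbij : Function.Bijective (S.place x) := Finite.injective_iff_bijective.1 (S.inj x)
    rw [Finset.sum_range, ← hbij.sum_comp]
    refine Finset.sum_congr rfl fun k _ => ?_
    have : Nonempty (Fin n) := ⟨k⟩
    simp only [strategyArr, Fin.is_lt, dif_pos, Fin.eta]
    rw [Function.leftInverse_invFun (S.inj x)]
  rcases n with _ | n
  · simp [strategyCost]
  have h2 : ∑ j ∈ Finset.range n, |strategyArr S x j - p j| ≤
      ∑ j ∈ Finset.range (n + 1), |strategyArr S x j - p j| :=
    Finset.sum_le_sum_of_subset_of_nonneg (Finset.range_subset_range.2 (by omega))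
      fun _ _ _ => abs_nonneg _
  have h3 : ∑ j ∈ Finset.range n, |strategyArr S x (j + 1) - p (j + 1)| ≤
      ∑ j ∈ Finset.range (n + 1), |strategyArr S x j - p j| := by
    rw [Finset.sum_range_succ']
    exact le_add_of_nonneg_right (abs_nonneg _)
  have h4 : ∑ j ∈ Finset.range n, |p (j + 1) - p j| ≤
      ∑ j ∈ Finset.range (n + 1), |p (j + 1) - p j| :=
    Finset.sum_le_sum_of_subset_of_nonneg (Finset.range_subset_range.2 (by omega))
      fun _ _ _ => abs_nonneg _
  have h5 : strategyCost S x ≤ ∑ j ∈ Finset.range n, (|strategyArr S x (j + 1) - p (j + 1)| +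
      |p (j + 1) - p j| + |strategyArr S x j - p j|) := by
    rw [strategyCost, Nat.add_sub_cancel]
    refine Finset.sum_le_sum fun j _ => ?_
    rw [abs_sub_comm (strategyArr S x j)]
    refine (abs_sub_le _ (p j) _).trans (add_le_add_left (abs_sub_le _ _ _) _)
  rw [Finset.sum_add_distrib, Finset.sum_add_distrib] at h5
  linarith

lemma Placeable.exists_strategy {M n : ℕ} {cost : (ℕ → ℕ) → ℝ} {tv : ℝ}
    (H : Placeable M n cost tv) (hM : 0 < M) (hn : M ≤ n) :
    ∃ S : OnlineStrategy n, ∫ x, strategyCost S x ∂uniformCube n ≤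
      tv + 2 + 2 * (n / M + uniformExpectation M n cost) := by
  obtain ⟨f, p, hf, hfp⟩ := H M id (Set.injOn_id _) fun s hs => hs
  have hend : M + (n - M) = n := by omega
  rw [hend] at hfp
  have hflt : ∀ (y : Fin n → Fin M) (k : Fin n), f (extendTuple y) k < n := by
    intro y k
    rcases (hfp _ (extendTuple_lt hM y)).2.1 k k.isLt with ⟨s, hs, hs'⟩ | h
    · rw [hs']
      exact hs.trans_le hn
    · exact h.2
  let S : OnlineStrategy n :=
    { place := fun x k => ⟨f (extendTuple (letters hM x)) k, hflt _ k⟩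
      online := by
        intro x z k hxz
        ext
        refine hf _ _ _ fun i hi => ?_
        have hin : i < n := hi.trans_lt k.isLt
        simp only [extendTuple, dif_pos hin, letters]
        rw [hxz ⟨i, hin⟩ hi]
      inj := by
        intro x k₁ k₂ h
        have := (hfp _ (extendTuple_lt hM (letters hM x))).1 (by simp) (by simp)
          (Fin.val_eq_of_eq h)
        exact Fin.ext this
      meas := fun k =>
        (Measurable.of_discrete (f := fun y : Fin n → Fin M =>
          (⟨f (extendTuple y) k, hflt y k⟩ : Fin n))).comp (measurable_letters hM) }
  refine ⟨S, ?_⟩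
  have hle : ∀ᵐ x ∂uniformCube n, strategyCost S x ≤
      tv + 2 + 2 * (n / M + cost (extendTuple (letters hM x))) := by
    filter_upwards [ae_uniformCube_mem n] with x hx
    obtain ⟨-, -, g3, g4, g5, g6⟩ := hfp _ (extendTuple_lt hM (letters hM x))
    set y := extendTuple (letters hM x) with hy
    have h1 := strategyCost_le S x (p y)
    have h2 : ∑ j ∈ Finset.Ico 0 M, |p y (j + 1) - p y j| ≤ 2 := by
      refine sum_abs_sub_le_of_monotoneOn (fun j hj k hk hjk => ?_) g3
      have hj' := g4 j hj.2
      have hk' := g4 k hk.2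
      simp only [id] at hj' hk'
      rw [hj', hk']
      gcongr
    have h3 := Finset.sum_Ico_consecutive (fun j => |p y (j + 1) - p y j|) (Nat.zero_le M) hn
    rw [Finset.range_eq_Ico] at h1
    have h4 : ∑ k, |x k - p y (S.place x k)| ≤ n / M + cost y := by
      rw [Finset.sum_range] at g6
      have h5 : ∀ k : Fin n, |x k - p y (S.place x k)| ≤
          1 / M + |(y k : ℝ) / M - p y (f y k)| := by
        intro k
        refine (abs_sub_le _ ((y k : ℝ) / M) _).trans (add_le_add ?_ le_rfl)
        have := letter_spec hM (hx k)
        rw [hy, extendTuple_val, letters, abs_le]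
        have e : (((letter hM (x k) : ℕ) : ℝ) + 1) / M =
          ((letter hM (x k) : ℕ) : ℝ) / M + 1 / M := by ring
        rw [e] at this
        have h0 : (0 : ℝ) ≤ 1 / M := by positivity
        constructor <;> linarith [this.1, this.2]
      refine (Finset.sum_le_sum fun k _ => h5 k).trans ?_
      rw [Finset.sum_add_distrib, Finset.sum_const, Finset.card_univ, Fintype.card_fin,
        nsmul_eq_mul, mul_one_div]
      exact add_le_add le_rfl g6
    linarith
  have hcost : Integrable (fun x => cost (extendTuple (letters hM x))) (uniformCube n) :=
    integrable_comp_letters hM fun y => cost (extendTuple y)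
  have hsum : Integrable (fun x => (n : ℝ) / M + cost (extendTuple (letters hM x)))
      (uniformCube n) := (integrable_const _).add hcost
  calc ∫ x, strategyCost S x ∂uniformCube n
      ≤ ∫ x, (tv + 2 + 2 * (n / M + cost (extendTuple (letters hM x)))) ∂uniformCube n := by
        refine integral_mono_of_nonneg (Filter.Eventually.of_forall fun x =>
          Finset.sum_nonneg fun _ _ => abs_nonneg _) ?_ hle
        exact (integrable_const _).add (hsum.const_mul 2)
    _ = tv + 2 + 2 * (n / M + uniformExpectation M n cost) := by
        rw [integral_add (integrable_const _) (hsum.const_mul 2),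
          integral_const_mul, integral_add (integrable_const _) hcost, integral_comp_letters]
        simp

lemma exists_strategy_le (n : ℕ) (hn : 2 ≤ n) : ∃ (S : OnlineStrategy n) (J : ℕ), 2 ^ J ≤ n ∧
    ∫ x, strategyCost S x ∂uniformCube n ≤ (30 * geomBound + 98) * (J + 1) := by
  have hG := geomBound_nonneg
  rcases Nat.lt_or_ge n 24 with h24 | h24
  · obtain ⟨S, hS⟩ := (placeable_base (M := 1) (r := n) (by omega)).exists_strategy one_pos
      (by omega)
    refine ⟨S, 0, by simp; omega, hS.trans ?_⟩
    rw [(isUniformExpectation_uniformExpectation 1 n).apply_const one_pos]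
    have : (n : ℝ) ≤ 24 := by exact_mod_cast h24.le
    push_cast
    linarith
  · obtain ⟨J, hJ1, hJ2⟩ : ∃ J, 12 * 2 ^ J ≤ n ∧ n < 24 * 2 ^ J := by
      refine ⟨Nat.log 2 (n / 12), ?_, ?_⟩
      · have := Nat.pow_log_le_self 2 (x := n / 12) (by omega)
        omega
      · have := Nat.lt_pow_succ_log_self (b := 2) (by norm_num) (n / 12)
        rw [pow_succ] at this
        omega
    obtain ⟨m, hm1, hm2⟩ : ∃ m, 5 * n ≤ 8 * (m * 2 ^ J) ∧ 8 * (m * 2 ^ J) < 5 * n + 8 * 2 ^ J := by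
      refine ⟨(5 * n + 8 * 2 ^ J - 1) / (8 * 2 ^ J), ?_, ?_⟩
      · have h1 := Nat.lt_div_mul_add (a := 5 * n + 8 * 2 ^ J - 1) (b := 8 * 2 ^ J) (by positivity)
        have e : 8 * ((5 * n + 8 * 2 ^ J - 1) / (8 * 2 ^ J) * 2 ^ J) =
          (5 * n + 8 * 2 ^ J - 1) / (8 * 2 ^ J) * (8 * 2 ^ J) := by ring
        omega
      · have h1 := Nat.div_mul_le_self (5 * n + 8 * 2 ^ J - 1) (8 * 2 ^ J)
        have e : 8 * ((5 * n + 8 * 2 ^ J - 1) / (8 * 2 ^ J) * 2 ^ J) =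
          (5 * n + 8 * 2 ^ J - 1) / (8 * 2 ^ J) * (8 * 2 ^ J) := by ring
        omega
    have hm8 : 8 ≤ m := by
      by_contra! h
      have := Nat.mul_le_mul_right (2 ^ J) (Nat.le_of_lt_succ h)
      omega
    have hm16 : m ≤ 16 := by
      by_contra! h
      have := Nat.mul_le_mul_right (2 ^ J) (Nat.succ_le_of_lt h)
      omega
    have hmJ := Nat.mul_le_mul_right (2 ^ J) hm8
    obtain ⟨S, hS⟩ := (placeable_totalCost hm8 J n (by omega) (by omega)).exists_strategy
      (by positivity) (by omega)
    refine ⟨S, J, by omega, hS.trans ?_⟩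
    have h1 := (isUniformExpectation_uniformExpectation (m * 2 ^ J) n).apply_totalCost_le hm8
      J n (by omega) (by omega)
    have h2 : (n : ℝ) / (m * 2 ^ J : ℕ) ≤ 3 := by
      have : (0 : ℝ) < (m * 2 ^ J : ℕ) := by exact_mod_cast (by positivity : 0 < m * 2 ^ J)
      rw [div_le_iff₀ this]
      exact_mod_cast (by omega : n ≤ 3 * (m * 2 ^ J))
    have h3 : (m : ℝ) ≤ 16 := by exact_mod_cast hm16
    have h4 : (0 : ℝ) ≤ J := by positivity
    nlinarith

/-- There is a deterministic algorithm for stochastic online sorting achieving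
expected cost `log n · 2^{O(log* n)}`. -/
theorem stochastic_online_sorting_upper_bound :
    ∃ C : ℝ, 0 < C ∧ ∀ n : ℕ, 2 ≤ n → ∃ S : OnlineStrategy n,
      ∫ x, strategyCost S x ∂(uniformCube n) ≤
        C * Real.log n * (2 : ℝ) ^ (C * (logStar n : ℝ)) := by
  have hG := geomBound_nonneg
  refine ⟨4 * (30 * geomBound + 98), by positivity, fun n hn => ?_⟩
  obtain ⟨S, J, hJ, hS⟩ := exists_strategy_le n hn
  refine ⟨S, hS.trans ?_⟩
  have hn' : (2 : ℝ) ≤ n := by exact_mod_cast hn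
  have hlog2 : 1 / 2 ≤ Real.log 2 := by linarith [Real.log_two_gt_d9]
  have hlogn : 1 ≤ 2 * Real.log n := by linarith [Real.log_le_log two_pos hn']
  have hJlog : J ≤ 2 * Real.log n := by
    have h1 : Real.log (2 ^ J) ≤ Real.log n :=
      Real.log_le_log (by positivity) (by exact_mod_cast hJ)
    rw [Real.log_pow] at h1
    have h2 : (0 : ℝ) ≤ J := by positivity
    nlinarith
  have hpow : 1 ≤ (2 : ℝ) ^ (4 * (30 * geomBound + 98) * (logStar n : ℝ)) :=
    Real.one_le_rpow one_le_two (by positivity)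
  calc (30 * geomBound + 98) * (J + 1) ≤ (30 * geomBound + 98) * (4 * Real.log n) := by
        gcongr
        linarith
    _ = 4 * (30 * geomBound + 98) * Real.log n := by ring
    _ ≤ _ := le_mul_of_one_le_right (mul_nonneg (by positivity) (by linarith)) hpow
end
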